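/- arXiv:1403.3163 — 7 statements merged into one kernel-verified Lean document; each statement's English description precedes it below -/
import Mathlib

section
/- Assume 1 < α₀ ≤ α₂ < 2 and 0 < c₁ ≤ c₂, let α : ℝ^d → [α₀,α₂] and n : ℝ^d×ℝ^d → [c₁,c₂] be Borel measurable, and assume (H2) and (H3). Then condition (H4) holds: for every ε > 0 there exists r > 0 such that for all x, y ∈ ℝ^d with 0 < |x−y| ≤ r, | |x−y|^{α(x)∧α(y)−2} ∫_{{z : |x−y|/2 < |z| ≤ 1}} ⟨x−y, z⟩ [ n(y,z)/|z|^{d+α(y)} − n(x,z)/|z|^{d+α(x)} ] dz | ≤ ε. -/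
open MeasureTheory
open scoped RealInnerProductSpace

lemma aux_scale (D α₀ m ρ s : ℝ) (hD : 0 ≤ D) (h1 : 1 < α₀) (h2 : α₀ ≤ m) (h3 : m ≤ 2) (hρ : 0 < ρ)
    (hs : ρ ≤ s) :
    (2 * ρ) ^ (m - 2) * ((2 * ρ) * s * s ^ (-(D + m))) ≤
      2 * 2 ^ (D + α₀ - 1) * ρ ^ (-D) * (1 + s / ρ) ^ (-(D + α₀ - 1)) := by
  obtain ⟨t, ht⟩ : ∃ t, t = s / ρ := ⟨_, rfl⟩
  have hst : s = ρ * t := by rw [ht]; field_simp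
  have ht1 : 1 ≤ t := by rw [ht, le_div_iff₀ hρ]; linarith
  have ht0 : 0 < t := by linarith
  rw [← ht, hst]
  have e1 : (2 * ρ) ^ (m - 2) * ((2 * ρ) * (ρ * t) * (ρ * t) ^ (-(D + m)))
      = 2 ^ (m - 1) * ρ ^ (-D) * t ^ (-(D + m - 1)) := by
    rw [Real.mul_rpow (by norm_num) hρ.le, Real.mul_rpow hρ.le ht0.le]
    have a1 : (2 : ℝ) ^ (m - 1) = 2 ^ (m - 2) * 2 := by
      rw [← Real.rpow_add_one (by norm_num)]; congr 1; ring
    have a2 : t ^ (-(D + m - 1)) = t ^ (-(D + m)) * t := by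
      rw [← Real.rpow_add_one ht0.ne']; congr 1; ring
    have a3 : ρ ^ (-D) = ρ ^ (m - 2) * ρ ^ (-(D + m)) * ρ * ρ := by
      rw [← Real.rpow_add hρ, ← Real.rpow_add_one hρ.ne', ← Real.rpow_add_one hρ.ne']
      congr 1; ring
    rw [a1, a2, a3]; ring
  rw [e1]
  have b1 : (2 : ℝ) ^ (m - 1) ≤ 2 := by
    calc (2 : ℝ) ^ (m - 1) ≤ 2 ^ (1 : ℝ) :=
          Real.rpow_le_rpow_of_exponent_le (by norm_num) (by linarith)
      _ = 2 := by norm_num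
  have b2 : t ^ (-(D + m - 1)) ≤ t ^ (-(D + α₀ - 1)) :=
    Real.rpow_le_rpow_of_exponent_le ht1 (by linarith)
  have b3 : t ^ (-(D + α₀ - 1)) ≤ 2 ^ (D + α₀ - 1) * (1 + t) ^ (-(D + α₀ - 1)) := by
    calc t ^ (-(D + α₀ - 1)) ≤ ((1 + t) / 2) ^ (-(D + α₀ - 1)) :=
          Real.rpow_le_rpow_of_nonpos (by linarith) (by linarith) (by linarith)
      _ = 2 ^ (D + α₀ - 1) * (1 + t) ^ (-(D + α₀ - 1)) := by
          rw [Real.div_rpow (by linarith) (by norm_num), Real.rpow_neg (by norm_num : (0 : ℝ) ≤ 2)]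
          field_simp
  have hρD : 0 < ρ ^ (-D) := Real.rpow_pos_of_pos hρ _
  calc 2 ^ (m - 1) * ρ ^ (-D) * t ^ (-(D + m - 1))
      ≤ 2 * ρ ^ (-D) * (2 ^ (D + α₀ - 1) * (1 + t) ^ (-(D + α₀ - 1))) := by
        have := b2.trans b3
        gcongr
    _ = _ := by ring

lemma aux_log (a b h s η : ℝ) (hη : 0 < η) (hab : a ≤ b) (h0 : 0 < h) (hh : h ≤ 1 / 2)
    (hs : h / 2 < s) (hu : (b - a) * Real.log (1 / h) ≤ Real.log (1 + η) / 2) :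
    s ^ (-(b - a)) ≤ 1 + η := by
  have hs0 : 0 < s := by linarith
  rw [Real.rpow_def_of_pos hs0, ← Real.le_log_iff_exp_le (by linarith)]
  have l1 : Real.log (h / 2) ≤ Real.log s := Real.log_le_log (by linarith) hs.le
  have l2 : Real.log (h * h) ≤ Real.log (h / 2) := Real.log_le_log (by positivity) (by nlinarith)
  rw [Real.log_mul h0.ne' h0.ne'] at l2
  rw [one_div, Real.log_inv] at hu
  nlinarith

lemma aux_core (D a b s η c₂ N N' : ℝ) (hc : 0 < c₂) (hab : a ≤ b) (hs : 0 < s) (hs1 : s ≤ 1)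
    (hN : 0 ≤ N) (hN2 : N ≤ c₂) (hNN : |N - N'| ≤ η / 2)
    (hl : s ^ (-(b - a)) ≤ 1 + η / (2 * c₂)) :
    |N / s ^ (D + b) - N' / s ^ (D + a)| ≤ η * s ^ (-(D + a)) := by
  have e1 : N / s ^ (D + b) = N * s ^ (-(b - a)) * s ^ (-(D + a)) := by
    rw [mul_assoc, ← Real.rpow_add hs, div_eq_mul_inv, ← Real.rpow_neg hs.le]
    congr 2; ring
  have e2 : N' / s ^ (D + a) = N' * s ^ (-(D + a)) := by
    rw [div_eq_mul_inv, ← Real.rpow_neg hs.le]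
  rw [e1, e2, ← sub_mul, abs_mul, abs_of_pos (Real.rpow_pos_of_pos hs (-(D + a)))]
  have hp := Real.rpow_pos_of_pos hs (-(D + a))
  gcongr
  have l0 : 1 ≤ s ^ (-(b - a)) := Real.one_le_rpow_of_pos_of_le_one_of_nonpos hs hs1 (by linarith)
  have l1 : N * (s ^ (-(b - a)) - 1) ≤ c₂ * (η / (2 * c₂)) := by
    apply mul_le_mul hN2 (by linarith) (by linarith) hc.le
  have l2 : c₂ * (η / (2 * c₂)) = η / 2 := by field_simp
  have l3 : 0 ≤ N * (s ^ (-(b - a)) - 1) := mul_nonneg hN (by linarith)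
  rw [abs_le] at *
  constructor <;> nlinarith

/-- Proposition: if `1 < α₀ ≤ α₂ < 2`, `0 < c₁ ≤ c₂`, `α : ℝ^d → [α₀,α₂]` and
`n : ℝ^d×ℝ^d → [c₁,c₂]` are Borel measurable and satisfy (H2) and (H3), then (H4) holds. -/
theorem stmt_1 (d : ℕ) (hd : 1 ≤ d) (α₀ α₂ c₁ c₂ : ℝ)
    (h1 : 1 < α₀) (h2 : α₀ ≤ α₂) (h3 : α₂ < 2) (hc1 : 0 < c₁) (hc2 : c₁ ≤ c₂)
    (α : EuclideanSpace ℝ (Fin d) → ℝ)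
    (n : EuclideanSpace ℝ (Fin d) → EuclideanSpace ℝ (Fin d) → ℝ)
    (hαm : Measurable α)
    (hnm : Measurable fun p : EuclideanSpace ℝ (Fin d) × EuclideanSpace ℝ (Fin d) => n p.1 p.2)
    (hαr : ∀ x, α x ∈ Set.Icc α₀ α₂)
    (hnr : ∀ x z, n x z ∈ Set.Icc c₁ c₂)
    -- (H2)
    (hH2 : ∀ ε > 0, ∃ δ > 0, ∀ x y : EuclideanSpace ℝ (Fin d),
      0 < ‖x - y‖ → ‖x - y‖ ≤ δ → |α x - α y| * Real.log (1 / ‖x - y‖) ≤ ε)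
    -- (H3)
    (hH3 : ∀ ε > 0, ∃ r > 0,
      (∀ (x z₁ z₂ : EuclideanSpace ℝ (Fin d)), ‖z₁ - z₂‖ ≤ r → |n x z₁ - n x z₂| ≤ ε) ∧
      (∀ (x y z : EuclideanSpace ℝ (Fin d)), ‖z‖ ≤ 1 → ‖x - y‖ ≤ r → |n x z - n y z| ≤ ε)) :
    -- (H4)
    ∀ ε > 0, ∃ r > 0, ∀ x y : EuclideanSpace ℝ (Fin d), 0 < ‖x - y‖ → ‖x - y‖ ≤ r →
      |‖x - y‖ ^ (min (α x) (α y) - 2) *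
        ∫ z in {z : EuclideanSpace ℝ (Fin d) | ‖x - y‖ / 2 < ‖z‖ ∧ ‖z‖ ≤ 1},
          ⟪x - y, z⟫ * (n y z / ‖z‖ ^ ((d : ℝ) + α y) - n x z / ‖z‖ ^ ((d : ℝ) + α x))| ≤ ε := by
  intro ε hε
  obtain ⟨p, hp⟩ : ∃ p, p = (d : ℝ) + α₀ - 1 := ⟨_, rfl⟩
  obtain ⟨K, hK⟩ : ∃ K, K = ∫ w : EuclideanSpace ℝ (Fin d), (1 + ‖w‖) ^ (-p) := ⟨_, rfl⟩
  have hG : Integrable (fun w : EuclideanSpace ℝ (Fin d) => (1 + ‖w‖) ^ (-p)) := by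
    apply integrable_one_add_norm
    rw [finrank_euclideanSpace_fin]; linarith
  have hK0 : 0 ≤ K := by rw [hK]; exact integral_nonneg fun w => by positivity
  have hc2' : 0 < c₂ := by linarith
  obtain ⟨C, hC⟩ : ∃ C : ℝ, C = 2 * 2 ^ p := ⟨_, rfl⟩
  have hC0 : 0 < C := by rw [hC]; positivity
  obtain ⟨η, hη⟩ : ∃ η, η = ε / (C * K + 1) := ⟨_, rfl⟩
  have hη0 : 0 < η := by rw [hη]; positivity
  have hηε : η * (C * K) ≤ ε := by
    rw [hη, div_mul_eq_mul_div, div_le_iff₀ (by positivity)]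
    nlinarith
  obtain ⟨δ, hδ, H2⟩ := hH2 (Real.log (1 + η / (2 * c₂)) / 2) (by
    have : 0 < Real.log (1 + η / (2 * c₂)) :=
      Real.log_pos (by linarith [show 0 < η / (2 * c₂) by positivity])
    linarith)
  obtain ⟨r, hr, -, H3⟩ := hH3 (η / 2) (by linarith)
  refine ⟨min (1 / 2) (min δ r), by positivity, ?_⟩
  intro x y hxy hle
  have hle1 : ‖x - y‖ ≤ 1 / 2 := hle.trans (min_le_left _ _)
  have hle2 : ‖x - y‖ ≤ δ := hle.trans ((min_le_right _ _).trans (min_le_left _ _))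
  have hle3 : ‖x - y‖ ≤ r := hle.trans ((min_le_right _ _).trans (min_le_right _ _))
  have hu := H2 x y hxy hle2
  obtain ⟨ρ, hρ⟩ : ∃ ρ, ρ = ‖x - y‖ / 2 := ⟨_, rfl⟩
  have hρ0 : 0 < ρ := by rw [hρ]; linarith
  have hh : ‖x - y‖ = 2 * ρ := by rw [hρ]; ring
  set m := min (α x) (α y) with hm
  have hm1 : α₀ ≤ m := le_min (hαr x).1 (hαr y).1
  have hm2 : m ≤ 2 := (min_le_left _ _).trans (by linarith [(hαr x).2])
  -- difference of kernels
  have hker : ∀ z : EuclideanSpace ℝ (Fin d), ‖x - y‖ / 2 < ‖z‖ → ‖z‖ ≤ 1 →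
      |n y z / ‖z‖ ^ ((d : ℝ) + α y) - n x z / ‖z‖ ^ ((d : ℝ) + α x)|
        ≤ η * ‖z‖ ^ (-((d : ℝ) + m)) := by
    intro z hz hz1
    have hz0 : 0 < ‖z‖ := by linarith
    have hn := H3 x y z hz1 hle3
    have hη' : 0 < η / (2 * c₂) := by positivity
    rcases le_total (α x) (α y) with hab | hab
    · rw [hm, min_eq_left hab]
      rw [abs_sub_comm, abs_of_nonneg (by linarith)] at hu
      refine aux_core d (α x) (α y) ‖z‖ η c₂ _ _ hc2' hab hz0 hz1 (by linarith [(hnr y z).1])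
        (hnr y z).2 (by rw [abs_sub_comm]; exact hn) ?_
      exact aux_log _ _ _ _ _ hη' hab hxy hle1 hz hu
    · rw [hm, min_eq_right hab, abs_sub_comm]
      rw [abs_of_nonneg (by linarith)] at hu
      refine aux_core d (α y) (α x) ‖z‖ η c₂ _ _ hc2' hab hz0 hz1 (by linarith [(hnr x z).1])
        (hnr x z).2 hn ?_
      exact aux_log _ _ _ _ _ hη' hab hxy hle1 hz hu
  have hGs : Integrable (fun z : EuclideanSpace ℝ (Fin d) => (1 + ‖ρ⁻¹ • z‖) ^ (-p)) :=
    hG.comp_smul (inv_ne_zero hρ0.ne')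
  have hGi : ∫ z : EuclideanSpace ℝ (Fin d), (1 + ‖ρ⁻¹ • z‖) ^ (-p) = ρ ^ d * K := by
    rw [Measure.integral_comp_smul volume
      (fun w : EuclideanSpace ℝ (Fin d) => (1 + ‖w‖) ^ (-p)) ρ⁻¹, ← hK,
      finrank_euclideanSpace_fin, smul_eq_mul, inv_pow, inv_inv, abs_of_pos (by positivity)]
  have hGc : Integrable (fun z : EuclideanSpace ℝ (Fin d) =>
      η * (C * ρ ^ (-(d : ℝ))) * (1 + ‖ρ⁻¹ • z‖) ^ (-p)) := hGs.const_mul _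
  have hmeas : MeasurableSet
      {z : EuclideanSpace ℝ (Fin d) | ‖x - y‖ / 2 < ‖z‖ ∧ ‖z‖ ≤ 1} :=
    (measurableSet_lt measurable_const measurable_norm).inter
      (measurableSet_le measurable_norm measurable_const)
  rw [← integral_const_mul, ← Real.norm_eq_abs]
  calc _ ≤ ∫ z in {z : EuclideanSpace ℝ (Fin d) | ‖x - y‖ / 2 < ‖z‖ ∧ ‖z‖ ≤ 1},
        η * (C * ρ ^ (-(d : ℝ))) * (1 + ‖ρ⁻¹ • z‖) ^ (-p) := by
        apply norm_integral_le_of_norm_le hGc.integrableOn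
        refine (ae_restrict_iff' hmeas).2 (Filter.Eventually.of_forall ?_)
        rintro z ⟨hz, hz1⟩
        have hz0 : 0 < ‖z‖ := by linarith
        have hk := hker z hz hz1
        have hi := abs_real_inner_le_norm (x - y) z
        have hsc := aux_scale d α₀ m ρ ‖z‖ (by positivity) h1 hm1 hm2 hρ0 (by rw [hρ]; exact hz.le)
        rw [← hh, ← hp, ← hC] at hsc
        rw [norm_smul, norm_inv, Real.norm_eq_abs ρ, abs_of_pos hρ0, inv_mul_eq_div,
          Real.norm_eq_abs, abs_mul, abs_mul, abs_of_pos (Real.rpow_pos_of_pos hxy _)]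
        calc _ ≤ ‖x - y‖ ^ (m - 2) * ((‖x - y‖ * ‖z‖) * (η * ‖z‖ ^ (-((d : ℝ) + m)))) := by
              gcongr
          _ = η * (‖x - y‖ ^ (m - 2) * (‖x - y‖ * ‖z‖ * ‖z‖ ^ (-((d : ℝ) + m)))) := by ring
          _ ≤ η * (C * ρ ^ (-(d : ℝ)) * (1 + ‖z‖ / ρ) ^ (-p)) := by gcongr
          _ = _ := by ring
    _ ≤ ∫ z : EuclideanSpace ℝ (Fin d), η * (C * ρ ^ (-(d : ℝ))) * (1 + ‖ρ⁻¹ • z‖) ^ (-p) :=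
        setIntegral_le_integral hGc (Filter.Eventually.of_forall fun z => by
          simp only [Pi.zero_apply]; positivity)
    _ = η * (C * K) := by
        rw [integral_const_mul, hGi, Real.rpow_neg hρ0.le, Real.rpow_natCast]
        have : ρ ^ d ≠ 0 := by positivity
        field_simp
    _ ≤ ε := hηε
end

section
/- Assume 0 < α₀ ≤ α₂ < 1 and 0 < c₁ ≤ c₂, let α : ℝ^d → [α₀,α₂] and n : ℝ^d×ℝ^d → [c₁,c₂] be Borel measurable, assume (H2) and (H3), and assume moreover: for every ε > 0 there exists r > 0 such that for all x, y ∈ ℝ^d with 0 < |x−y| ≤ r, ( |α(x)−α(y)| + sup_{|z|≤1} |n(x,z)−n(y,z)| ) / |x−y|^{1−α(x)∧α(y)} ≤ ε. Then condition (H4) holds: for every ε > 0 there exists r > 0 such that for all x, y ∈ ℝ^d with 0 < |x−y| ≤ r, | |x−y|^{α(x)∧α(y)−2} ∫_{{z : |x−y|/2 < |z| ≤ 1}} ⟨x−y, z⟩ [ n(y,z)/|z|^{d+α(y)} − n(x,z)/|z|^{d+α(x)} ] dz | ≤ ε. -/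
open MeasureTheory
open scoped RealInnerProductSpace

lemma aux_rpow_diff (t p q M s : ℝ) (ht : 0 < t) (ht1 : t ≤ 1) (hs : 0 < s)
    (hpq : p ≤ q) (hq : q ≤ M) :
    |t ^ (-p) - t ^ (-q)| ≤ |p - q| * (t ^ (-(M + s)) / s) := by
  have e1 : t ^ (-p) = t ^ (-q) * t ^ (q - p) := by
    rw [← Real.rpow_add ht]; congr 1; ring
  have hqpos : 0 < t ^ (-q) := Real.rpow_pos_of_pos ht _
  have h1 : t ^ (q - p) ≤ 1 := Real.rpow_le_one ht.le ht1 (by linarith)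
  have h2 : 1 - t ^ (q - p) ≤ (q - p) * (-Real.log t) := by
    rw [Real.rpow_def_of_pos ht]
    have := Real.add_one_le_exp (Real.log t * (q - p))
    linarith
  have h3 : -Real.log t ≤ t ^ (-s) / s := by
    have := Real.log_le_rpow_div (inv_nonneg.2 ht.le) hs
    rwa [Real.log_inv, Real.inv_rpow ht.le, ← Real.rpow_neg ht.le] at this
  have h4 : t ^ (-q) ≤ t ^ (-M) := Real.rpow_le_rpow_of_exponent_ge ht ht1 (by linarith)
  have h5 : t ^ (-(M + s)) = t ^ (-M) * t ^ (-s) := by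
    rw [← Real.rpow_add ht]; congr 1; ring
  have hspos : 0 < t ^ (-s) := Real.rpow_pos_of_pos ht _
  rw [e1, abs_of_nonpos (by nlinarith), abs_of_nonpos (by linarith), h5]
  calc -(t ^ (-q) * t ^ (q - p) - t ^ (-q)) = t ^ (-q) * (1 - t ^ (q - p)) := by ring
    _ ≤ t ^ (-M) * ((q - p) * (t ^ (-s) / s)) := by
        apply mul_le_mul h4 _ (by linarith) (by positivity)
        exact h2.trans (mul_le_mul_of_nonneg_left h3 (by linarith))
    _ = _ := by ring

lemma aux_rpow_diff' (t p q M s : ℝ) (ht : 0 < t) (ht1 : t ≤ 1) (hs : 0 < s)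
    (hp : p ≤ M) (hq : q ≤ M) :
    |t ^ (-p) - t ^ (-q)| ≤ |p - q| * (t ^ (-(M + s)) / s) := by
  rcases le_total p q with h | h
  · exact aux_rpow_diff t p q M s ht ht1 hs h hq
  · rw [abs_sub_comm, abs_sub_comm p]
    exact aux_rpow_diff t q p M s ht ht1 hs h hp

lemma aux_integrable (d : ℕ) (hd : 1 ≤ d) (b : ℝ) (hb : b < 1) :
    IntegrableOn (fun z : EuclideanSpace ℝ (Fin d) => ‖z‖ ^ (1 - (d : ℝ) - b))
      {z | ‖z‖ ≤ 1} := by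
  have : Nonempty (Fin d) := ⟨⟨0, hd⟩⟩
  have hm : MeasurableSet {z : EuclideanSpace ℝ (Fin d) | ‖z‖ ≤ 1} :=
    measurableSet_le measurable_norm measurable_const
  rw [← integrable_indicator_iff hm]
  have key := (integrable_fun_norm_addHaar (volume : Measure (EuclideanSpace ℝ (Fin d)))
    (f := (Set.Iic (1:ℝ)).indicator fun t => t ^ (1 - (d : ℝ) - b))).1
  have key2 := (integrable_fun_norm_addHaar (volume : Measure (EuclideanSpace ℝ (Fin d)))
    (f := (Set.Iic (1:ℝ)).indicator fun t => t ^ (1 - (d : ℝ) - b))).2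
  clear key
  refine (key2 ?_).congr (Filter.Eventually.of_forall fun z => by simp [Set.indicator])
  have : IntegrableOn (fun t : ℝ => t ^ (-b)) (Set.Ioc 0 1) := by
    rw [← intervalIntegrable_iff_integrableOn_Ioc_of_le zero_le_one]
    exact intervalIntegral.intervalIntegrable_rpow' (by linarith)
  rw [← integrable_indicator_iff measurableSet_Ioc] at this
  rw [← integrable_indicator_iff measurableSet_Ioi]
  refine this.congr (Filter.Eventually.of_forall fun t => ?_)
  by_cases h0 : 0 < t
  · by_cases h1 : t ≤ 1
    · simp only [Set.indicator, Set.mem_Ioc, Set.mem_Ioi, Set.mem_Iic, h0, h1, and_self, if_true,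
        finrank_euclideanSpace, Fintype.card_fin, smul_eq_mul]
      rw [← Real.rpow_natCast, ← Real.rpow_add h0, Nat.cast_sub hd]
      congr 1; push_cast; ring
    · simp [Set.indicator, h0, h1]
  · simp [Set.indicator, h0]

/-- Proposition: if `0 < α₀ ≤ α₂ < 1`, `0 < c₁ ≤ c₂`, `α : ℝ^d → [α₀,α₂]` and
`n : ℝ^d×ℝ^d → [c₁,c₂]` are Borel measurable, satisfy (H2), (H3) and condition
`(|α(x)−α(y)| + sup_{|z|≤1}|n(x,z)−n(y,z)|)/|x−y|^{1−α(x)∧α(y)} → 0`, then (H4) holds. -/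
theorem stmt_2 (d : ℕ) (hd : 1 ≤ d) (α₀ α₂ c₁ c₂ : ℝ)
    (h1 : 0 < α₀) (h2 : α₀ ≤ α₂) (h3 : α₂ < 1) (hc1 : 0 < c₁) (hc2 : c₁ ≤ c₂)
    (α : EuclideanSpace ℝ (Fin d) → ℝ)
    (n : EuclideanSpace ℝ (Fin d) → EuclideanSpace ℝ (Fin d) → ℝ)
    (hαm : Measurable α)
    (hnm : Measurable fun p : EuclideanSpace ℝ (Fin d) × EuclideanSpace ℝ (Fin d) => n p.1 p.2)
    (hαr : ∀ x, α x ∈ Set.Icc α₀ α₂)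
    (hnr : ∀ x z, n x z ∈ Set.Icc c₁ c₂)
    -- (H2)
    (hH2 : ∀ ε > 0, ∃ δ > 0, ∀ x y : EuclideanSpace ℝ (Fin d),
      0 < ‖x - y‖ → ‖x - y‖ ≤ δ → |α x - α y| * Real.log (1 / ‖x - y‖) ≤ ε)
    -- (H3)
    (hH3 : ∀ ε > 0, ∃ r > 0,
      (∀ (x z₁ z₂ : EuclideanSpace ℝ (Fin d)), ‖z₁ - z₂‖ ≤ r → |n x z₁ - n x z₂| ≤ ε) ∧
      (∀ (x y z : EuclideanSpace ℝ (Fin d)), ‖z‖ ≤ 1 → ‖x - y‖ ≤ r → |n x z - n y z| ≤ ε))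
    -- additional condition (3.2) of the paper
    (hadd : ∀ ε > 0, ∃ r > 0, ∀ x y : EuclideanSpace ℝ (Fin d), 0 < ‖x - y‖ → ‖x - y‖ ≤ r →
      ∀ z : EuclideanSpace ℝ (Fin d), ‖z‖ ≤ 1 →
        (|α x - α y| + |n x z - n y z|) / ‖x - y‖ ^ (1 - min (α x) (α y)) ≤ ε) :
    -- (H4)
    ∀ ε > 0, ∃ r > 0, ∀ x y : EuclideanSpace ℝ (Fin d), 0 < ‖x - y‖ → ‖x - y‖ ≤ r →
      |‖x - y‖ ^ (min (α x) (α y) - 2) *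
        ∫ z in {z : EuclideanSpace ℝ (Fin d) | ‖x - y‖ / 2 < ‖z‖ ∧ ‖z‖ ≤ 1},
          ⟪x - y, z⟫ * (n y z / ‖z‖ ^ ((d : ℝ) + α y) - n x z / ‖z‖ ^ ((d : ℝ) + α x))| ≤ ε := by
  intro ε hε
  obtain ⟨s, hsdef⟩ : ∃ s, s = (1 - α₂) / 2 := ⟨_, rfl⟩
  have hs : 0 < s := by linarith
  have hc2p : 0 < c₂ := by linarith
  have hint := aux_integrable d hd (α₂ + s) (by linarith)
  obtain ⟨C, hC⟩ : ∃ C, C = ∫ z in {z : EuclideanSpace ℝ (Fin d) | ‖z‖ ≤ 1},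
    ‖z‖ ^ (1 - (d : ℝ) - (α₂ + s)) := ⟨_, rfl⟩
  have hC0 : 0 ≤ C := hC ▸ integral_nonneg fun z => by positivity
  have hK : 0 < 1 + c₂ / s := by positivity
  obtain ⟨K, hKdef⟩ : ∃ K, K = 1 + c₂ / s := ⟨_, rfl⟩
  rw [← hKdef] at hK
  obtain ⟨r, hr, H⟩ := hadd (ε / (K * (C + 1))) (by positivity)
  refine ⟨r, hr, fun x y hxy hxyr => ?_⟩
  have H := H x y hxy hxyr
  obtain ⟨e, he⟩ : ∃ e, e = ε / (K * (C + 1)) := ⟨_, rfl⟩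
  have he0 : 0 < e := by rw [he]; positivity
  rw [← he] at H
  obtain ⟨h, hh⟩ : ∃ h, h = ‖x - y‖ := ⟨_, rfl⟩
  obtain ⟨a, ha⟩ : ∃ a, a = min (α x) (α y) := ⟨_, rfl⟩
  rw [← hh, ← ha] at H
  rw [← hh] at hxy
  have hpow : 0 < h ^ (1 - a) := Real.rpow_pos_of_pos hxy _
  have hsub : {z : EuclideanSpace ℝ (Fin d) | ‖x - y‖ / 2 < ‖z‖ ∧ ‖z‖ ≤ 1} ⊆ {z | ‖z‖ ≤ 1} :=
    fun z hz => hz.2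
  have hm : MeasurableSet {z : EuclideanSpace ℝ (Fin d) | ‖x - y‖ / 2 < ‖z‖ ∧ ‖z‖ ≤ 1} :=
    (measurableSet_lt measurable_const measurable_norm).inter
      (measurableSet_le measurable_norm measurable_const)
  have hbound : |∫ z in {z : EuclideanSpace ℝ (Fin d) | ‖x - y‖ / 2 < ‖z‖ ∧ ‖z‖ ≤ 1},
      ⟪x - y, z⟫ * (n y z / ‖z‖ ^ ((d : ℝ) + α y) - n x z / ‖z‖ ^ ((d : ℝ) + α x))|
      ≤ h * (e * h ^ (1 - a) * K) * C := by
    have h1 : |∫ z in {z : EuclideanSpace ℝ (Fin d) | ‖x - y‖ / 2 < ‖z‖ ∧ ‖z‖ ≤ 1},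
      ⟪x - y, z⟫ * (n y z / ‖z‖ ^ ((d : ℝ) + α y) - n x z / ‖z‖ ^ ((d : ℝ) + α x))|
      ≤ ∫ z in {z : EuclideanSpace ℝ (Fin d) | ‖x - y‖ / 2 < ‖z‖ ∧ ‖z‖ ≤ 1},
        h * (e * h ^ (1 - a) * K) * ‖z‖ ^ (1 - (d : ℝ) - (α₂ + s)) := by
      rw [← Real.norm_eq_abs]
      refine norm_integral_le_of_norm_le ((hint.mono_set hsub).const_mul _) ?_
      refine (ae_restrict_iff' hm).2 (Filter.Eventually.of_forall fun z hz => ?_)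
      obtain ⟨hz0, hz1⟩ := hz
      have Hz := H z hz1
      rw [div_le_iff₀ hpow] at Hz
      rw [← hh] at hz0
      have ht : 0 < ‖z‖ := by linarith
      obtain ⟨t, htdef⟩ : ∃ t, t = ‖z‖ := ⟨_, rfl⟩
      have hin : |⟪x - y, z⟫| ≤ h * t := by
        rw [hh, htdef]; exact abs_real_inner_le_norm _ _
      rw [← htdef] at ht hz1 ⊢
      have hd1 := aux_rpow_diff' t (d + α y) (d + α x) (d + α₂) s ht hz1 hs
        (by linarith [(hαr y).2]) (by linarith [(hαr x).2])
      have hd2 : t ^ (-((d : ℝ) + α y)) ≤ t ^ (-((d : ℝ) + α₂ + s)) :=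
        Real.rpow_le_rpow_of_exponent_ge ht hz1 (by linarith [(hαr y).2])
      obtain ⟨T, hT⟩ : ∃ T, T = t ^ (-((d : ℝ) + α₂ + s)) := ⟨_, rfl⟩
      rw [← hT] at hd1 hd2
      have hT0 : 0 < T := by rw [hT]; exact Real.rpow_pos_of_pos ht _
      have hTT : t ^ (1 - (d : ℝ) - (α₂ + s)) = t * T := by
        rw [hT, ← Real.rpow_one_add' ht.le]
        · congr 1; ring
        · have : (1 : ℝ) ≤ d := by exact_mod_cast hd
          linarith
      have hp0 : 0 < t ^ (-((d : ℝ) + α y)) := Real.rpow_pos_of_pos ht _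
      rw [div_eq_mul_inv, div_eq_mul_inv, ← Real.rpow_neg ht.le, ← Real.rpow_neg ht.le, hTT,
        norm_mul, Real.norm_eq_abs, Real.norm_eq_abs]
      have hmain : |n y z * t ^ (-((d : ℝ) + α y)) - n x z * t ^ (-((d : ℝ) + α x))|
          ≤ e * h ^ (1 - a) * K * T := by
        have e1 : n y z * t ^ (-((d : ℝ) + α y)) - n x z * t ^ (-((d : ℝ) + α x))
          = (n y z - n x z) * t ^ (-((d : ℝ) + α y))
            + n x z * (t ^ (-((d : ℝ) + α y)) - t ^ (-((d : ℝ) + α x))) := by ring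
        have e2 : |(d : ℝ) + α y - (d + α x)| = |α x - α y| := by
          rw [abs_sub_comm]; congr 1; ring
        rw [e2] at hd1
        have hn0 : |n x z| ≤ c₂ := by
          rw [abs_of_nonneg (by linarith [(hnr x z).1])]; exact (hnr x z).2
        have hA : |n y z - n x z| ≤ e * h ^ (1 - a) := by
          rw [abs_sub_comm]; linarith [abs_nonneg (α x - α y)]
        have hB : |α x - α y| ≤ e * h ^ (1 - a) := by
          linarith [abs_nonneg (n x z - n y z)]
        rw [e1]
        refine (abs_add_le _ _).trans ?_
        rw [abs_mul, abs_mul, abs_of_pos hp0]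
        have g1 : |n y z - n x z| * t ^ (-((d : ℝ) + α y)) ≤ e * h ^ (1 - a) * T :=
          mul_le_mul hA hd2 hp0.le (by positivity)
        have g2 : |n x z| * |t ^ (-((d : ℝ) + α y)) - t ^ (-((d : ℝ) + α x))|
            ≤ c₂ * (e * h ^ (1 - a) * (T / s)) :=
          mul_le_mul hn0 (hd1.trans (mul_le_mul_of_nonneg_right hB (by positivity)))
            (abs_nonneg _) hc2p.le
        calc _ ≤ e * h ^ (1 - a) * T + c₂ * (e * h ^ (1 - a) * (T / s)) := add_le_add g1 g2
          _ = _ := by rw [hKdef]; ring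
      calc _ ≤ (h * t) * (e * h ^ (1 - a) * K * T) :=
            mul_le_mul hin hmain (abs_nonneg _) (by positivity)
        _ = _ := by ring
    refine h1.trans ?_
    rw [integral_const_mul, hC]
    refine mul_le_mul_of_nonneg_left ?_ (by positivity)
    exact setIntegral_mono_set hint (Filter.Eventually.of_forall fun z => by
      simp only [Pi.zero_apply]; positivity) hsub.eventuallyLE
  rw [abs_mul, ← hh, ← ha, abs_of_pos (Real.rpow_pos_of_pos hxy _)]
  rw [← hh] at hbound
  refine (mul_le_mul_of_nonneg_left hbound (Real.rpow_pos_of_pos hxy _).le).trans ?_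
  have hprod : h ^ (a - 2) * (h * h ^ (1 - a)) = 1 := by
    nth_rewrite 2 [← Real.rpow_one h]
    rw [← Real.rpow_add hxy, ← Real.rpow_add hxy]
    ring_nf
    exact Real.rpow_zero h
  calc _ = (h ^ (a - 2) * (h * h ^ (1 - a))) * (e * K * C) := by ring
    _ = e * K * C := by rw [hprod, one_mul]
    _ ≤ e * K * (C + 1) := by gcongr; linarith
    _ = ε := by rw [he]; field_simp
end

section
/- Let g, h ∈ C_b²(ℝ^d) and set H(x,y) = g(x) + h(y). Then for all x, y ∈ ℝ^d with x ≠ y, all the integrals defining L̃₁H(x,y), L̃₂H(x,y), Lg(x) and Lh(y) converge absolutely and L̃H(x,y) = L̃₁H(x,y) + L̃₂H(x,y) = Lg(x) + Lh(y); that is, L̃ is a coupling operator of L. -/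
open MeasureTheory
open scoped RealInnerProductSpace

noncomputable section

/-- `ℝ^d` as a Euclidean space. -/
abbrev Eu (d : ℕ) := EuclideanSpace ℝ (Fin d)

/-- `C_b²`: twice continuously differentiable with bounded `f`, `∇f`, `∇²f`. -/
def Cb2 {F : Type*} [NormedAddCommGroup F] [NormedSpace ℝ F] (f : F → ℝ) : Prop :=
  ContDiff ℝ 2 f ∧ (∃ C, ∀ x, |f x| ≤ C) ∧ (∃ C, ∀ x, ‖fderiv ℝ f x‖ ≤ C) ∧
    (∃ C, ∀ x, ‖fderiv ℝ (fderiv ℝ f) x‖ ≤ C)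

variable (d : ℕ)

/-- The reflection `φ_{x,y}(z) = z − (2⟨x−y,z⟩/|x−y|²)(x−y)`. -/
def reflMap (x y z : Eu d) : Eu d := z - ((2 * ⟪x - y, z⟫) / ‖x - y‖ ^ 2) • (x - y)

/-- `ñ(x,y,z) = min{n(x,z), n(y,z), n(x,φ_{x,y}(z)), n(y,φ_{x,y}(z))}`. -/
def ntilde (n : Eu d → Eu d → ℝ) (x y z : Eu d) : ℝ :=
  min (min (n x z) (n y z)) (min (n x (reflMap d x y z)) (n y (reflMap d x y z)))

/-- `K(x,y,z) = ñ(x,y,z)/max(|z|^{d+α(x)}, |z|^{d+α(y)})`. -/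
def Kker (α : Eu d → ℝ) (n : Eu d → Eu d → ℝ) (x y z : Eu d) : ℝ :=
  ntilde d n x y z / max (‖z‖ ^ ((d : ℝ) + α x)) (‖z‖ ^ ((d : ℝ) + α y))

/-- the kernel `min(n(x,z),n(y,z))/max(|z|^{d+α(x)},|z|^{d+α(y)})` for large jumps. -/
def Kout (α : Eu d → ℝ) (n : Eu d → Eu d → ℝ) (x y z : Eu d) : ℝ :=
  min (n x z) (n y z) / max (‖z‖ ^ ((d : ℝ) + α x)) (‖z‖ ^ ((d : ℝ) + α y))

/-- the kernel `n(x,z)/|z|^{d+α(x)}` of `L`. -/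
def KL (α : Eu d → ℝ) (n : Eu d → Eu d → ℝ) (x z : Eu d) : ℝ :=
  n x z / ‖z‖ ^ ((d : ℝ) + α x)

/-- gradient of `F` in the first variable. -/
def gradX (F : Eu d × Eu d → ℝ) (x y : Eu d) : Eu d := gradient (fun u => F (u, y)) x

/-- gradient of `F` in the second variable. -/
def gradY (F : Eu d × Eu d → ℝ) (x y : Eu d) : Eu d := gradient (fun v => F (x, v)) y

/-- Integrand of `L f(x)`. -/
def LInt (α : Eu d → ℝ) (n : Eu d → Eu d → ℝ) (f : Eu d → ℝ) (x z : Eu d) : ℝ :=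
  (f (x + z) - f x - (if ‖z‖ ≤ 1 then ⟪gradient f x, z⟫ else 0)) * KL d α n x z

/-- First integrand of `L̃₁`: reflection coupling of the jump `z` for the first marginal. -/
def A1 (α : Eu d → ℝ) (n : Eu d → Eu d → ℝ) (F : Eu d × Eu d → ℝ) (x y z : Eu d) : ℝ :=
  (F (x + z, y + reflMap d x y z) - F (x, y) -
      (if ‖z‖ ≤ 1 then ⟪gradX d F x y, z⟫ + ⟪gradY d F x y, reflMap d x y z⟫ else 0)) *
    Kker d α n x y z

/-- Second integrand of `L̃₁`. -/
def A2 (α : Eu d → ℝ) (n : Eu d → Eu d → ℝ) (F : Eu d × Eu d → ℝ) (x y z : Eu d) : ℝ :=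
  (F (x + reflMap d x y z, y + z) - F (x, y) -
      (if ‖z‖ ≤ 1 then ⟪gradY d F x y, z⟫ + ⟪gradX d F x y, reflMap d x y z⟫ else 0)) *
    Kker d α n x y z

/-- Third integrand of `L̃₁`. -/
def A3 (α : Eu d → ℝ) (n : Eu d → Eu d → ℝ) (F : Eu d × Eu d → ℝ) (x y z : Eu d) : ℝ :=
  (F (x + z, y) - F (x, y) - (if ‖z‖ ≤ 1 then ⟪gradX d F x y, z⟫ else 0)) *
    (KL d α n x z - Kker d α n x y z)

/-- Fourth integrand of `L̃₁`. -/
def A4 (α : Eu d → ℝ) (n : Eu d → Eu d → ℝ) (F : Eu d × Eu d → ℝ) (x y z : Eu d) : ℝ :=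
  (F (x, y + z) - F (x, y) - (if ‖z‖ ≤ 1 then ⟪gradY d F x y, z⟫ else 0)) *
    (KL d α n y z - Kker d α n x y z)

/-- First integrand of `L̃₂`: synchronous coupling of large jumps. -/
def B1 (α : Eu d → ℝ) (n : Eu d → Eu d → ℝ) (F : Eu d × Eu d → ℝ) (x y z : Eu d) : ℝ :=
  (F (x + z, y + z) - F (x, y) -
      (if ‖z‖ ≤ 1 then ⟪gradX d F x y, z⟫ + ⟪gradY d F x y, z⟫ else 0)) *
    Kout d α n x y z

/-- Second integrand of `L̃₂`. -/
def B2 (α : Eu d → ℝ) (n : Eu d → Eu d → ℝ) (F : Eu d × Eu d → ℝ) (x y z : Eu d) : ℝ :=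
  (F (x + z, y) - F (x, y) - (if ‖z‖ ≤ 1 then ⟪gradX d F x y, z⟫ else 0)) *
    (KL d α n x z - Kout d α n x y z)

/-- Third integrand of `L̃₂`. -/
def B3 (α : Eu d → ℝ) (n : Eu d → Eu d → ℝ) (F : Eu d × Eu d → ℝ) (x y z : Eu d) : ℝ :=
  (F (x, y + z) - F (x, y) - (if ‖z‖ ≤ 1 then ⟪gradY d F x y, z⟫ else 0)) *
    (KL d α n y z - Kout d α n x y z)

/-- Domain of the small-jump part: `{0 < |z| ≤ |x−y|/2}`. -/
def SIn (x y : Eu d) : Set (Eu d) := {z | 0 < ‖z‖ ∧ ‖z‖ ≤ ‖x - y‖ / 2}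

/-- Domain of the large-jump part: `{|z| > |x−y|/2}`. -/
def SOut (x y : Eu d) : Set (Eu d) := {z | ‖x - y‖ / 2 < ‖z‖}

/-- The operator `L`. -/
def Lop (α : Eu d → ℝ) (n : Eu d → Eu d → ℝ) (f : Eu d → ℝ) (x : Eu d) : ℝ :=
  ∫ z in {z : Eu d | z ≠ 0}, LInt d α n f x z

/-- The small-jump part `L̃₁` of the coupling operator. -/
def tildeL1 (α : Eu d → ℝ) (n : Eu d → Eu d → ℝ) (F : Eu d × Eu d → ℝ) (x y : Eu d) : ℝ :=
  (1 / 2) * (∫ z in SIn d x y, A1 d α n F x y z) +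
    (1 / 2) * (∫ z in SIn d x y, A2 d α n F x y z) +
    (∫ z in SIn d x y, A3 d α n F x y z) + ∫ z in SIn d x y, A4 d α n F x y z

/-- The large-jump part `L̃₂` of the coupling operator. -/
def tildeL2 (α : Eu d → ℝ) (n : Eu d → Eu d → ℝ) (F : Eu d × Eu d → ℝ) (x y : Eu d) : ℝ :=
  (∫ z in SOut d x y, B1 d α n F x y z) + (∫ z in SOut d x y, B2 d α n F x y z) +
    ∫ z in SOut d x y, B3 d α n F x y z

/-- Compensated increment. -/
def DD {d : ℕ} (f : Eu d → ℝ) (x z : Eu d) : ℝ :=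
  f (x + z) - f x - (if ‖z‖ ≤ 1 then ⟪gradient f x, z⟫ else 0)

theorem DD_measurable {d : ℕ} (f : Eu d → ℝ) (hf : Cb2 f) (x : Eu d) : Measurable (DD f x) := by
  have hc : Continuous f := hf.1.continuous
  have h1 : Measurable fun z : Eu d => f (x + z) - f x :=
    (by fun_prop : Continuous fun z : Eu d => f (x + z) - f x).measurable
  have h2 : Measurable fun z : Eu d => ⟪gradient f x, z⟫ :=
    (by fun_prop : Continuous fun z : Eu d => ⟪gradient f x, z⟫).measurable
  exact h1.sub (Measurable.ite (measurableSet_le measurable_norm measurable_const) h2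
    measurable_const)

theorem DD_bound {d : ℕ} (f : Eu d → ℝ) (hf : Cb2 f) (x : Eu d) :
    ∃ C, 0 ≤ C ∧ ∀ z, |DD f x z| ≤ C * min 1 (‖z‖ ^ 2) := by
  obtain ⟨hcd, ⟨C0, hC0⟩, -, ⟨C2, hC2⟩⟩ := hf
  have hC0n : 0 ≤ C0 := (abs_nonneg _).trans (hC0 x)
  have hC2n : 0 ≤ C2 := (norm_nonneg (fderiv ℝ (fderiv ℝ f) x)).trans (hC2 x)
  refine ⟨2 * C0 + C2, by positivity, fun z => ?_⟩
  unfold DD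
  split_ifs with hz
  · have hd1 : Differentiable ℝ f := hcd.differentiable (by norm_num)
    have hd2 : Differentiable ℝ (fderiv ℝ f) :=
      (hcd.fderiv_right (m := 1) (by norm_num)).differentiable (by norm_num)
    have hlip : ∀ u, ‖fderiv ℝ f u - fderiv ℝ f x‖ ≤ C2 * ‖u - x‖ := fun u =>
      convex_univ.norm_image_sub_le_of_norm_fderiv_le (𝕜 := ℝ) (fun v _ => hd2 v)
        (fun v _ => hC2 v) (Set.mem_univ x) (Set.mem_univ u)
    have hb := (convex_closedBall x ‖z‖).norm_image_sub_le_of_norm_fderiv_le' (𝕜 := ℝ)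
      (f := f) (φ := fderiv ℝ f x) (C := C2 * ‖z‖) (x := x) (y := x + z)
      (fun v _ => hd1 v)
      (fun v hv => (hlip v).trans (by
        rw [mem_closedBall_iff_norm] at hv
        exact mul_le_mul_of_nonneg_left hv hC2n))
      (Metric.mem_closedBall_self (norm_nonneg _)) (by simp [mem_closedBall_iff_norm])
    have hgr : ⟪gradient f x, z⟫ = fderiv ℝ f x z := by
      simp [gradient, InnerProductSpace.toDual_symm_apply]
    rw [add_sub_cancel_left, Real.norm_eq_abs] at hb
    rw [hgr]
    have hz2 : ‖z‖ ^ 2 ≤ 1 := by nlinarith [norm_nonneg z]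
    rw [min_eq_right hz2]
    nlinarith [sq_nonneg ‖z‖]
  · push Not at hz
    have hz2 : 1 ≤ ‖z‖ ^ 2 := by nlinarith [norm_nonneg z]
    rw [min_eq_left hz2, sub_zero]
    have h1 := abs_sub (f (x + z)) (f x)
    linarith [hC0 (x + z), hC0 x]

theorem base_integrable {d : ℕ} (hd : 1 ≤ d) (a : ℝ) (ha0 : 0 < a) (ha2 : a < 2) :
    Integrable (fun z : Eu d => min 1 (‖z‖ ^ 2) / ‖z‖ ^ ((d : ℝ) + a)) := by
  have : Nonempty (Fin d) := ⟨⟨0, hd⟩⟩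
  have : Nontrivial (Eu d) := inferInstance
  refine (integrable_fun_norm_addHaar (volume : Measure (Eu d))
    (f := fun r : ℝ => min 1 (r ^ 2) / r ^ ((d : ℝ) + a))).2 ?_
  have hfin : Module.finrank ℝ (Eu d) = d := by simp
  rw [hfin]
  have key : ∀ r : ℝ, 0 < r → r ^ (d - 1) • (min 1 (r ^ 2) / r ^ ((d : ℝ) + a))
      = min 1 (r ^ 2) * r ^ (-1 - a) := by
    intro r hr
    rw [smul_eq_mul, ← Real.rpow_natCast r (d - 1), Nat.cast_sub hd, mul_div_left_comm,
      ← Real.rpow_sub hr]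
    congr 2
    push_cast; ring
  rw [← Set.Ioc_union_Ioi_eq_Ioi zero_le_one]
  refine IntegrableOn.union ?_ ?_
  · have h1 : IntegrableOn (fun r : ℝ => r ^ (1 - a)) (Set.Ioc 0 1) :=
      (intervalIntegrable_iff_integrableOn_Ioc_of_le zero_le_one).1
        (intervalIntegral.intervalIntegrable_rpow' (by linarith))
    refine h1.congr_fun (fun r hr => ?_) measurableSet_Ioc
    have hr0 : 0 < r := hr.1
    have hr2 : r ^ 2 ≤ 1 := by nlinarith [hr.2]
    simp only [key r hr0]
    rw [min_eq_right hr2, ← Real.rpow_natCast r 2, ← Real.rpow_add hr0]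
    congr 1
    push_cast; ring
  · have h1 : IntegrableOn (fun r : ℝ => r ^ (-1 - a)) (Set.Ioi 1) :=
      integrableOn_Ioi_rpow_of_lt (by linarith) zero_lt_one
    refine h1.congr_fun (fun r hr => ?_) measurableSet_Ioi
    have hr1 : 1 < r := hr
    have hr2 : 1 ≤ r ^ 2 := by nlinarith
    simp only [key r (by linarith)]
    rw [min_eq_left hr2, one_mul]

theorem mul_integrable {d : ℕ} (hd : 1 ≤ d) (a c C : ℝ) (ha0 : 0 < a) (ha2 : a < 2)
    (hC : 0 ≤ C) (D k : Eu d → ℝ) (hD : Measurable D) (hk : Measurable k)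
    (hDb : ∀ z, |D z| ≤ C * min 1 (‖z‖ ^ 2)) (hkb : ∀ z, |k z| ≤ c / ‖z‖ ^ ((d : ℝ) + a)) :
    Integrable (fun z => D z * k z) := by
  refine ((base_integrable hd a ha0 ha2).const_mul (C * c)).mono'
    (hD.mul hk).aestronglyMeasurable (Filter.Eventually.of_forall fun z => ?_)
  rw [Real.norm_eq_abs, abs_mul]
  calc |D z| * |k z| ≤ (C * min 1 (‖z‖ ^ 2)) * (c / ‖z‖ ^ ((d : ℝ) + a)) := by
        apply mul_le_mul (hDb z) (hkb z) (abs_nonneg _)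
        positivity
    _ = _ := by ring

/-- The reflection as an isometry. -/
def reflIso {d : ℕ} (x y : Eu d) : Eu d ≃ₗᵢ[ℝ] Eu d := (ℝ ∙ (x - y))ᗮ.reflection

theorem reflIso_apply {d : ℕ} (x y z : Eu d) : reflIso x y z = reflMap d x y z := by
  unfold reflIso reflMap
  rw [Submodule.reflection_orthogonal_apply, Submodule.reflection_singleton_apply, neg_sub,
    two_smul, ← add_smul]
  congr 2
  simp only [RCLike.ofReal_real_eq_id, id]
  ring

theorem reflMap_norm {d : ℕ} (x y z : Eu d) : ‖reflMap d x y z‖ = ‖z‖ := by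
  rw [← reflIso_apply, LinearIsometryEquiv.norm_map]

theorem reflMap_invol {d : ℕ} (x y z : Eu d) : reflMap d x y (reflMap d x y z) = z := by
  rw [← reflIso_apply, ← reflIso_apply]
  exact Submodule.reflection_reflection _ z

theorem reflMap_measurable {d : ℕ} (x y : Eu d) : Measurable (reflMap d x y) := by
  have : reflMap d x y = reflIso x y := funext fun z => (reflIso_apply x y z).symm
  rw [this]
  exact (reflIso x y).continuous.measurable

theorem Kker_refl {d : ℕ} (α : Eu d → ℝ) (n : Eu d → Eu d → ℝ) (x y z : Eu d) :
    Kker d α n x y (reflMap d x y z) = Kker d α n x y z := by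
  unfold Kker ntilde
  rw [reflMap_norm, reflMap_invol, min_comm]

theorem setIntegral_refl {d : ℕ} (α : Eu d → ℝ) (n : Eu d → Eu d → ℝ) (x y : Eu d)
    (D : Eu d → ℝ) :
    ∫ z in SIn d x y, D (reflMap d x y z) * Kker d α n x y z
      = ∫ z in SIn d x y, D z * Kker d α n x y z := by
  have h := (reflIso x y).measurePreserving.setIntegral_preimage_emb
    (reflIso x y).toHomeomorph.measurableEmbedding (fun z => D z * Kker d α n x y z) (SIn d x y)
  have hs : (reflIso x y) ⁻¹' (SIn d x y) = SIn d x y := by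
    ext z
    simp [SIn]
  rw [hs] at h
  rw [← h]
  simp only [reflIso_apply, Kker_refl]

theorem div_max_bound {r p q m c : ℝ} (hr : 0 ≤ r) (hp : 0 < p) (hq : 0 < q) (hm : 0 ≤ m)
    (hmc : m ≤ c) : |m / max (r ^ p) (r ^ q)| ≤ c / r ^ p := by
  rcases hr.eq_or_lt with rfl | hr
  · simp [Real.zero_rpow hp.ne', Real.zero_rpow hq.ne']
  · have h1 : 0 < r ^ p := Real.rpow_pos_of_pos hr p
    have h2 : r ^ p ≤ max (r ^ p) (r ^ q) := le_max_left _ _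
    rw [abs_of_nonneg (div_nonneg hm (h1.le.trans h2))]
    exact div_le_div₀ (hm.trans hmc) hmc h1 h2

/-- `L̃` is a coupling operator of `L`: for `g, h ∈ C_b²(ℝ^d)` and
`H(x,y) = g(x) + h(y)`, all integrals defining `L̃₁H(x,y)`, `L̃₂H(x,y)`, `Lg(x)`,
`Lh(y)` converge absolutely, and `L̃H(x,y) = L̃₁H(x,y) + L̃₂H(x,y) = Lg(x) + Lh(y)`. -/
theorem stmt_4 (d : ℕ) (hd : 1 ≤ d) (α₀ α₂ c₁ c₂ : ℝ)
    (h0 : 0 < α₀) (h1 : α₀ ≤ α₂) (h2 : α₂ < 2) (hc1 : 0 < c₁) (hc2 : c₁ ≤ c₂)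
    (α : Eu d → ℝ) (n : Eu d → Eu d → ℝ)
    (hαm : Measurable α) (hnm : Measurable fun p : Eu d × Eu d => n p.1 p.2)
    (hαr : ∀ x, α x ∈ Set.Icc α₀ α₂) (hnr : ∀ x z, n x z ∈ Set.Icc c₁ c₂)
    (g h : Eu d → ℝ) (hg : Cb2 g) (hh : Cb2 h)
    (H : Eu d × Eu d → ℝ) (hH : ∀ p, H p = g p.1 + h p.2)
    (x y : Eu d) (hxy : x ≠ y) :
    IntegrableOn (A1 d α n H x y) (SIn d x y) ∧
    IntegrableOn (A2 d α n H x y) (SIn d x y) ∧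
    IntegrableOn (A3 d α n H x y) (SIn d x y) ∧
    IntegrableOn (A4 d α n H x y) (SIn d x y) ∧
    IntegrableOn (B1 d α n H x y) (SOut d x y) ∧
    IntegrableOn (B2 d α n H x y) (SOut d x y) ∧
    IntegrableOn (B3 d α n H x y) (SOut d x y) ∧
    IntegrableOn (LInt d α n g x) {z : Eu d | z ≠ 0} ∧
    IntegrableOn (LInt d α n h y) {z : Eu d | z ≠ 0} ∧
    tildeL1 d α n H x y + tildeL2 d α n H x y = Lop d α n g x + Lop d α n h y := by
  have hnx : ∀ u, Measurable (n u) := fun u => hnm.comp (measurable_const.prodMk measurable_id)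
  have hdx : ∀ u, 0 < (d : ℝ) + α u := fun u => by
    have := (hαr u).1
    have : (0 : ℝ) ≤ d := Nat.cast_nonneg d
    linarith
  have ha0 : ∀ u, 0 < α u := fun u => h0.trans_le (hαr u).1
  have ha2 : ∀ u, α u < 2 := fun u => (hαr u).2.trans_lt h2
  have hpm : ∀ u, Measurable fun z : Eu d => ‖z‖ ^ ((d : ℝ) + α u) := fun u =>
    measurable_norm.pow_const _
  have hrm := reflMap_measurable x y
  have mp : ∀ u, Measurable (KL d α n u) := fun u => (hnx u).div (hpm u)
  have mk : Measurable (Kker d α n x y) :=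
    (((hnx x).min (hnx y)).min (((hnx x).comp hrm).min ((hnx y).comp hrm))).div
      ((hpm x).max (hpm y))
  have mo : Measurable (Kout d α n x y) :=
    ((hnx x).min (hnx y)).div ((hpm x).max (hpm y))
  have npos : ∀ u z, 0 ≤ n u z := fun u z => hc1.le.trans (hnr u z).1
  have bp : ∀ u z, |KL d α n u z| ≤ c₂ / ‖z‖ ^ ((d : ℝ) + α u) := fun u z => by
    have hP : 0 ≤ ‖z‖ ^ ((d : ℝ) + α u) := by positivity
    unfold KL
    rw [abs_of_nonneg (div_nonneg (npos u z) hP)]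
    exact div_le_div_of_nonneg_right (hnr u z).2 hP
  have bk : ∀ z, |Kker d α n x y z| ≤ c₂ / ‖z‖ ^ ((d : ℝ) + α x) := fun z =>
    div_max_bound (norm_nonneg z) (hdx x) (hdx y)
      (le_min (le_min (npos _ _) (npos _ _)) (le_min (npos _ _) (npos _ _)))
      ((min_le_left _ _).trans ((min_le_left _ _).trans (hnr x z).2))
  have bo : ∀ z, |Kout d α n x y z| ≤ c₂ / ‖z‖ ^ ((d : ℝ) + α x) := fun z =>
    div_max_bound (norm_nonneg z) (hdx x) (hdx y)
      (le_min (npos _ _) (npos _ _)) ((min_le_left _ _).trans (hnr x z).2)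
  obtain ⟨Cg, hCg, bG⟩ := DD_bound g hg x
  obtain ⟨Ch, hCh, bH⟩ := DD_bound h hh y
  have mG := DD_measurable g hg x
  have mH := DD_measurable h hh y
  have bGr : ∀ z, |DD g x (reflMap d x y z)| ≤ Cg * min 1 (‖z‖ ^ 2) := fun z => by
    simpa only [reflMap_norm] using bG (reflMap d x y z)
  have bHr : ∀ z, |DD h y (reflMap d x y z)| ≤ Ch * min 1 (‖z‖ ^ 2) := fun z => by
    simpa only [reflMap_norm] using bH (reflMap d x y z)
  have iGp := mul_integrable hd (α x) c₂ Cg (ha0 x) (ha2 x) hCg _ _ mG (mp x) bG (bp x)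
  have iHq := mul_integrable hd (α y) c₂ Ch (ha0 y) (ha2 y) hCh _ _ mH (mp y) bH (bp y)
  have iGk := mul_integrable hd (α x) c₂ Cg (ha0 x) (ha2 x) hCg _ _ mG mk bG bk
  have iHk := mul_integrable hd (α x) c₂ Ch (ha0 x) (ha2 x) hCh _ _ mH mk bH bk
  have iGo := mul_integrable hd (α x) c₂ Cg (ha0 x) (ha2 x) hCg _ _ mG mo bG bo
  have iHo := mul_integrable hd (α x) c₂ Ch (ha0 x) (ha2 x) hCh _ _ mH mo bH bo
  have iGrk := mul_integrable hd (α x) c₂ Cg (ha0 x) (ha2 x) hCg _ _ (mG.comp hrm) mk bGr bk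
  have iHrk := mul_integrable hd (α x) c₂ Ch (ha0 x) (ha2 x) hCh _ _ (mH.comp hrm) mk bHr bk
  simp only [Function.comp_apply] at iGrk iHrk
  have gX : gradX d H x y = gradient g x := by
    have : (fun u => H (u, y)) = fun u => g u + h y := funext fun u => hH _
    simp only [gradX, gradient, this, fderiv_add_const]
  have gY : gradY d H x y = gradient h y := by
    have : (fun v => H (x, v)) = fun v => g x + h v := funext fun v => hH _
    simp only [gradY, gradient, this, fderiv_const_add]
  have eA1 : A1 d α n H x y = fun z => DD g x z * Kker d α n x y z
      + DD h y (reflMap d x y z) * Kker d α n x y z := by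
    funext z
    simp only [A1, DD, gX, gY, hH, reflMap_norm]
    split_ifs <;> ring
  have eA2 : A2 d α n H x y = fun z => DD g x (reflMap d x y z) * Kker d α n x y z
      + DD h y z * Kker d α n x y z := by
    funext z
    simp only [A2, DD, gX, gY, hH, reflMap_norm]
    split_ifs <;> ring
  have eA3 : A3 d α n H x y = fun z => DD g x z * KL d α n x z
      - DD g x z * Kker d α n x y z := by
    funext z
    simp only [A3, DD, gX, gY, hH]
    ring
  have eA4 : A4 d α n H x y = fun z => DD h y z * KL d α n y z
      - DD h y z * Kker d α n x y z := by
    funext z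
    simp only [A4, DD, gX, gY, hH]
    ring
  have eB1 : B1 d α n H x y = fun z => DD g x z * Kout d α n x y z
      + DD h y z * Kout d α n x y z := by
    funext z
    simp only [B1, DD, gX, gY, hH]
    split_ifs <;> ring
  have eB2 : B2 d α n H x y = fun z => DD g x z * KL d α n x z
      - DD g x z * Kout d α n x y z := by
    funext z
    simp only [B2, DD, gX, gY, hH]
    ring
  have eB3 : B3 d α n H x y = fun z => DD h y z * KL d α n y z
      - DD h y z * Kout d α n x y z := by
    funext z
    simp only [B3, DD, gX, gY, hH]
    ring
  have eLg : LInt d α n g x = fun z => DD g x z * KL d α n x z := rfl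
  have eLh : LInt d α n h y = fun z => DD h y z * KL d α n y z := rfl
  have hST : {z : Eu d | z ≠ 0} = SIn d x y ∪ SOut d x y := by
    have hpos : 0 < ‖x - y‖ := norm_pos_iff.2 (sub_ne_zero.2 hxy)
    ext z
    simp only [SIn, SOut, Set.mem_union, Set.mem_ofPred_eq, ← norm_pos_iff]
    constructor
    · intro hz
      rcases le_or_gt ‖z‖ (‖x - y‖ / 2) with h | h
      · exact Or.inl ⟨hz, h⟩
      · exact Or.inr h
    · rintro (h | h)
      · exact h.1
      · linarith
  have hdisj : Disjoint (SIn d x y) (SOut d x y) := by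
    rw [Set.disjoint_left]
    intro z hz hz'
    exact absurd hz.2 (not_le.2 hz')
  have mOut : MeasurableSet (SOut d x y) := measurableSet_lt measurable_const measurable_norm
  have hR1 := setIntegral_refl α n x y (DD g x)
  have hR2 := setIntegral_refl α n x y (DD h y)
  rw [tildeL1, tildeL2, Lop, Lop, eA1, eA2, eA3, eA4, eB1, eB2, eB3, eLg, eLh]
  refine ⟨(iGk.add iHrk).integrableOn, (iGrk.add iHk).integrableOn,
    (iGp.sub iGk).integrableOn, (iHq.sub iHk).integrableOn, (iGo.add iHo).integrableOn,
    (iGp.sub iGo).integrableOn, (iHq.sub iHo).integrableOn, iGp.integrableOn,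
    iHq.integrableOn, ?_⟩
  rw [hST, setIntegral_union hdisj mOut iGp.integrableOn iGp.integrableOn,
    setIntegral_union hdisj mOut iHq.integrableOn iHq.integrableOn,
    integral_add iGk.integrableOn iHrk.integrableOn,
    integral_add iGrk.integrableOn iHk.integrableOn,
    integral_sub iGp.integrableOn iGk.integrableOn,
    integral_sub iHq.integrableOn iHk.integrableOn,
    integral_add iGo.integrableOn iHo.integrableOn,
    integral_sub iGp.integrableOn iGo.integrableOn,
    integral_sub iHq.integrableOn iHo.integrableOn, hR1, hR2]
  ring

end
end

section
/- Let 0 < c₁ ≤ c₂, let α : ℝ^d → (0,2) and n : ℝ^d×ℝ^d → [c₁,c₂] be Borel measurable, and fix x, y ∈ ℝ^d with x ≠ y. Define φ_{x,y}(z) = z − (2⟨x−y,z⟩/|x−y|²)(x−y), ñ(x,y,z) = min{n(x,z), n(y,z), n(x,φ_{x,y}(z)), n(y,φ_{x,y}(z))}, and K(z) = ñ(x,y,z)/max(|z|^{d+α(x)}, |z|^{d+α(y)}). Then the measure K(z) dz on ℝ^d∖{0} is invariant under z ↦ φ_{x,y}(z): for every Borel measurable g : ℝ^d → [0,∞], ∫_{ℝ^d∖{0}}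 g(φ_{x,y}(z)) K(z) dz = ∫_{ℝ^d∖{0}} g(z) K(z) dz. -/
open MeasureTheory
open scoped RealInnerProductSpace ENNReal

/-- The kernel `K(z) dz`, with
`K(z) = ñ(x,y,z)/max(|z|^{d+α(x)},|z|^{d+α(y)})`, is invariant under the
reflection `z ↦ φ_{x,y}(z)`. -/
theorem stmt_6 (d : ℕ) (hd : 1 ≤ d) (c₁ c₂ : ℝ) (hc1 : 0 < c₁) (hc2 : c₁ ≤ c₂)
    (α : EuclideanSpace ℝ (Fin d) → ℝ)
    (n : EuclideanSpace ℝ (Fin d) → EuclideanSpace ℝ (Fin d) → ℝ)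
    (hαm : Measurable α)
    (hnm : Measurable fun p : EuclideanSpace ℝ (Fin d) × EuclideanSpace ℝ (Fin d) => n p.1 p.2)
    (hαr : ∀ x, α x ∈ Set.Ioo (0:ℝ) 2)
    (hnr : ∀ x z, n x z ∈ Set.Icc c₁ c₂)
    (x y : EuclideanSpace ℝ (Fin d)) (hxy : x ≠ y)
    (φ : EuclideanSpace ℝ (Fin d) → EuclideanSpace ℝ (Fin d))
    (hφ : ∀ z, φ z = z - ((2 * ⟪x - y, z⟫) / ‖x - y‖ ^ 2) • (x - y))
    (K : EuclideanSpace ℝ (Fin d) → ℝ)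
    (hK : ∀ z, K z = min (min (n x z) (n y z)) (min (n x (φ z)) (n y (φ z))) /
      max (‖z‖ ^ ((d : ℝ) + α x)) (‖z‖ ^ ((d : ℝ) + α y))) :
    ∀ g : EuclideanSpace ℝ (Fin d) → ℝ≥0∞, Measurable g →
      ∫⁻ z in {z : EuclideanSpace ℝ (Fin d) | z ≠ 0}, g (φ z) * ENNReal.ofReal (K z) =
        ∫⁻ z in {z : EuclideanSpace ℝ (Fin d) | z ≠ 0}, g z * ENNReal.ofReal (K z) := by
  intro g _
  have hR : ∀ z, φ z = (ℝ ∙ (x - y))ᗮ.reflection z := by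
    intro z
    rw [hφ, Submodule.reflection_orthogonal_apply, Submodule.reflection_singleton_apply]
    simp only [RCLike.ofReal_real_eq_id, id_eq, two_smul, neg_sub]
    rw [← add_smul]
    congr 2
    ring
  have hinv : ∀ z, φ (φ z) = z := by
    intro z
    rw [hR, hR, Submodule.reflection_reflection]
  have hnorm : ∀ z, ‖φ z‖ = ‖z‖ := by
    intro z
    rw [hR, LinearIsometryEquiv.norm_map]
  have hKφ : ∀ z, K (φ z) = K z := by
    intro z
    rw [hK, hK, hinv, hnorm, min_comm]
  have hfun : φ = ⇑(ℝ ∙ (x - y))ᗮ.reflection := funext hR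
  have hmp : MeasurePreserving φ volume volume := by
    rw [hfun]
    exact LinearIsometryEquiv.measurePreserving _
  have hemb : MeasurableEmbedding φ := by
    rw [hfun]
    exact (ℝ ∙ (x - y))ᗮ.reflection.toHomeomorph.measurableEmbedding
  have h := hmp.setLIntegral_comp_preimage_emb hemb
    (fun z => g z * ENNReal.ofReal (K z)) {z | z ≠ 0}
  have hpre : φ ⁻¹' {z | z ≠ 0} = {z | z ≠ 0} := by
    ext z
    change φ z ≠ 0 ↔ z ≠ 0
    rw [← norm_ne_zero_iff, hnorm, norm_ne_zero_iff]
  rw [hpre] at h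
  simpa only [hKφ] using h
end

section
/- For every β ∈ (0,1) and every real s with 0 ≤ s ≤ 1, one has (1+s)^β + (1−s)^β ≤ 2 + β(β−1)s². -/
/-- The second-derivative bound. -/
lemma aux_two_le (p x : ℝ) (hp : p ≤ 0) (h1 : -1 < x) (h2 : x < 1) :
    2 ≤ (1 + x) ^ p + (1 - x) ^ p := by
  have hu : 0 < (1 + x) ^ p := Real.rpow_pos_of_pos (by linarith) _
  have hv : 0 < (1 - x) ^ p := Real.rpow_pos_of_pos (by linarith) _
  have huv : 1 ≤ (1 + x) ^ p * (1 - x) ^ p := by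
    rw [← Real.mul_rpow (by linarith) (by linarith)]
    exact Real.one_le_rpow_of_pos_of_le_one_of_nonpos
      (mul_pos (by linarith) (by linarith)) (by nlinarith [sq_nonneg x]) hp
  nlinarith [sq_nonneg ((1 + x) ^ p - (1 - x) ^ p)]

lemma aux_concave (β : ℝ) (hβ0 : 0 < β) (hβ1 : β < 1) :
    ConcaveOn ℝ (Set.Icc (-1 : ℝ) 1)
      (fun x : ℝ => (1 + x) ^ β + (1 - x) ^ β - β * (β - 1) * x ^ 2) := by
  refine concaveOn_of_hasDerivWithinAt2_nonpos (convex_Icc _ _)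
    (f' := fun x => β * (1 + x) ^ (β - 1) - β * (1 - x) ^ (β - 1) - β * (β - 1) * (2 * x))
    (f'' := fun x => β * (β - 1) * ((1 + x) ^ (β - 1 - 1) + (1 - x) ^ (β - 1 - 1) - 2))
    ?_ ?_ ?_ ?_
  · have hc : Continuous (fun x : ℝ => x ^ β) := Real.continuous_rpow_const hβ0.le
    have h1 : Continuous (fun x : ℝ => (1 + x) ^ β) := hc.comp (by fun_prop : Continuous fun x : ℝ => 1 + x)
    have h2 : Continuous (fun x : ℝ => (1 - x) ^ β) := hc.comp (by fun_prop : Continuous fun x : ℝ => 1 - x)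
    exact ((h1.add h2).sub (by fun_prop)).continuousOn
  all_goals
    intro x hx
    rw [interior_Icc] at hx
    obtain ⟨hx1, hx2⟩ := hx
    have ha : HasDerivAt (fun y : ℝ => 1 + y) 1 x := (hasDerivAt_id x).const_add 1
    have hb : HasDerivAt (fun y : ℝ => 1 - y) (-1) x := (hasDerivAt_id x).const_sub 1
    have hap : 1 + x ≠ 0 := by linarith
    have hbp : 1 - x ≠ 0 := by linarith
  · have h := ((ha.rpow_const (p := β) (Or.inl hap)).add
      (hb.rpow_const (p := β) (Or.inl hbp))).sub ((hasDerivAt_pow 2 x).const_mul (β * (β - 1)))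
    refine (h.congr_deriv ?_).hasDerivWithinAt
    simp; ring
  · have h := (((ha.rpow_const (p := β - 1) (Or.inl hap)).const_mul β).sub
      ((hb.rpow_const (p := β - 1) (Or.inl hbp)).const_mul β)).sub
      (((hasDerivAt_id x).const_mul 2).const_mul (β * (β - 1)))
    refine (h.congr_deriv ?_).hasDerivWithinAt
    ring
  · have h := aux_two_le (β - 1 - 1) x (by linarith) hx1 hx2
    exact mul_nonpos_of_nonpos_of_nonneg
      (mul_nonpos_of_nonneg_of_nonpos hβ0.le (by linarith)) (by linarith)

/-- For every `β ∈ (0,1)` and every `s ∈ [0,1]`,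
`(1+s)^β + (1−s)^β ≤ 2 + β(β−1)s²` (real powers). -/
theorem stmt_8 (β s : ℝ) (hβ0 : 0 < β) (hβ1 : β < 1) (hs0 : 0 ≤ s) (hs1 : s ≤ 1) :
    (1 + s) ^ β + (1 - s) ^ β ≤ 2 + β * (β - 1) * s ^ 2 := by
  have hm : s ∈ Set.Icc (-1 : ℝ) 1 := ⟨by linarith, hs1⟩
  have hm' : -s ∈ Set.Icc (-1 : ℝ) 1 := ⟨by linarith, by linarith⟩
  have h := (aux_concave β hβ0 hβ1).2 hm hm' (by norm_num : (0 : ℝ) ≤ 1 / 2)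
    (by norm_num : (0 : ℝ) ≤ 1 / 2) (by norm_num)
  have e : (1 / 2 : ℝ) • s + (1 / 2 : ℝ) • (-s) = 0 := by simp
  rw [e] at h
  simp only [smul_eq_mul, add_zero, sub_zero, Real.one_rpow, sub_neg_eq_add, ← sub_eq_add_neg,
    neg_sq] at h
  linarith
end

section
/- Let d ≥ 1, 0 < α₀ ≤ α₂ < 2 and β ∈ (0,1). Then there exists a constant C > 0 such that for every α ∈ [α₀,α₂] and every v ∈ ℝ^d with 0 < |v| ≤ 1, ∫_{{z : 0 < |z| ≤ |v|/2}} ( |v + (2⟨v,z⟩/|v|²)v|^β + |v − (2⟨v,z⟩/|v|²)v|^β − 2|v|^β ) |z|^{−(d+α)} dz ≤ −C |v|^{β−α}. (The integrand is nonpositive for |z| ≤ |v|/2, so the integral is well defined in [−∞,0].) -/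
open MeasureTheory
open scoped RealInnerProductSpace

lemma aux_nonpos {β : ℝ} (hβ0 : 0 < β) (hβ1 : β < 1) {t : ℝ} (ht : |t| ≤ 1) :
    (1 + t) ^ β + (1 - t) ^ β - 2 ≤ 0 := by
  obtain ⟨ha, hb⟩ := abs_le.1 ht
  have h := (Real.concaveOn_rpow hβ0.le hβ1.le).2
    (show 1 + t ∈ Set.Ici (0 : ℝ) by simp; linarith)
    (show 1 - t ∈ Set.Ici (0 : ℝ) by simp; linarith)
    (show (0 : ℝ) ≤ 1/2 by norm_num) (show (0 : ℝ) ≤ 1/2 by norm_num) (by norm_num)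
  have e : (1/2 : ℝ) • (1 + t) + (1/2 : ℝ) • (1 - t) = 1 := by simp only [smul_eq_mul]; ring
  simp only [e, Real.one_rpow] at h
  simp only [smul_eq_mul] at h
  linarith

lemma aux_neg {β : ℝ} (hβ0 : 0 < β) (hβ1 : β < 1) {t : ℝ} (ht : |t| ≤ 1) (h0 : t ≠ 0) :
    (1 + t) ^ β + (1 - t) ^ β - 2 < 0 := by
  obtain ⟨ha, hb⟩ := abs_le.1 ht
  have h := (Real.strictConcaveOn_rpow hβ0 hβ1).2
    (show 1 + t ∈ Set.Ici (0 : ℝ) by simp; linarith)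
    (show 1 - t ∈ Set.Ici (0 : ℝ) by simp; linarith)
    (by intro h; apply h0; linarith)
    (show (0 : ℝ) < 1/2 by norm_num) (show (0 : ℝ) < 1/2 by norm_num) (by norm_num)
  have e : (1/2 : ℝ) • (1 + t) + (1/2 : ℝ) • (1 - t) = 1 := by simp only [smul_eq_mul]; ring
  simp only [e, Real.one_rpow] at h
  simp only [smul_eq_mul] at h
  linarith

lemma aux_lower {β : ℝ} (hβ0 : 0 < β) (hβ1 : β < 1) {t : ℝ} (ht : |t| ≤ 1) :
    -(2 * t ^ 2) ≤ (1 + t) ^ β + (1 - t) ^ β - 2 := by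
  obtain ⟨ha, hb⟩ := abs_le.1 ht
  have hA : 0 ≤ 1 + t := by linarith
  have hB : 0 ≤ 1 - t := by linarith
  have h1 : (1 + t) ^ β * (1 - t) ^ β = (1 - t ^ 2) ^ β := by
    rw [← Real.mul_rpow hA hB]; congr 1; ring
  have h2 : 0 ≤ 1 - t ^ 2 := by nlinarith
  have h3 : 1 - t ^ 2 ≤ (1 - t ^ 2) ^ (β / 2) := by
    rcases h2.eq_or_lt with h | h
    · rw [← h]; positivity
    · calc 1 - t ^ 2 = (1 - t ^ 2) ^ (1 : ℝ) := (Real.rpow_one _).symm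
        _ ≤ _ := Real.rpow_le_rpow_of_exponent_ge h (by nlinarith [sq_nonneg t]) (by linarith)
  have h4 : (1 - t ^ 2) ^ β = ((1 - t ^ 2) ^ (β / 2)) ^ 2 := by
    rw [← Real.rpow_natCast ((1 - t ^ 2) ^ (β / 2)) 2, ← Real.rpow_mul h2]; congr 1; push_cast; ring
  have h5 := Real.rpow_nonneg hA β
  have h6 := Real.rpow_nonneg hB β
  have h7 : 2 * (1 - t ^ 2) ^ (β / 2) ≤ (1 + t) ^ β + (1 - t) ^ β := by
    refine (sq_le_sq₀ (by positivity) (by positivity)).1 ?_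
    nlinarith [sq_nonneg ((1 + t) ^ β - (1 - t) ^ β)]
  linarith

lemma aux_unif {β : ℝ} (hβ0 : 0 < β) (hβ1 : β < 1) :
    ∃ c > 0, ∀ t ∈ Set.Icc (1/2 : ℝ) 1, (1 + t) ^ β + (1 - t) ^ β - 2 ≤ -c := by
  have hc : ContinuousOn (fun t : ℝ => (1 + t) ^ β + (1 - t) ^ β - 2) (Set.Icc (1/2 : ℝ) 1) := by
    apply Continuous.continuousOn
    have h1 : Continuous fun t : ℝ => (1 + t) ^ β :=
      (by fun_prop : Continuous fun t : ℝ => 1 + t).rpow_const (fun _ => Or.inr hβ0.le)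
    have h2 : Continuous fun t : ℝ => (1 - t) ^ β :=
      (by fun_prop : Continuous fun t : ℝ => 1 - t).rpow_const (fun _ => Or.inr hβ0.le)
    fun_prop
  obtain ⟨x, hx, hm⟩ := isCompact_Icc.exists_isMaxOn ⟨1, by norm_num⟩ hc
  have hx1 : |x| ≤ 1 := abs_le.2 ⟨by linarith [hx.1], hx.2⟩
  have hn := aux_neg hβ0 hβ1 hx1 (by linarith [hx.1] : 0 < x).ne'
  refine ⟨_, neg_pos.2 hn, fun t ht => ?_⟩
  rw [neg_neg]
  exact hm ht

lemma aux_eq {d : ℕ} {β : ℝ} (v z : EuclideanSpace ℝ (Fin d)) {t : ℝ}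
    (ht : |t| ≤ 1) :
    ‖v + t • v‖ ^ β + ‖v - t • v‖ ^ β - 2 * ‖v‖ ^ β
      = ‖v‖ ^ β * ((1 + t) ^ β + (1 - t) ^ β - 2) := by
  obtain ⟨ha, hb⟩ := abs_le.1 ht
  have hA : 0 ≤ 1 + t := by linarith
  have hB : 0 ≤ 1 - t := by linarith
  have e1 : v + t • v = (1 + t) • v := by rw [add_smul, one_smul]
  have e2 : v - t • v = (1 - t) • v := by rw [sub_smul, one_smul]
  rw [e1, e2, norm_smul, norm_smul, Real.norm_of_nonneg hA, Real.norm_of_nonneg hB,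
    Real.mul_rpow hA (norm_nonneg _), Real.mul_rpow hB (norm_nonneg _)]
  ring

lemma aux_t {d : ℕ} (v z : EuclideanSpace ℝ (Fin d)) (hv : 0 < ‖v‖) :
    |(2 * ⟪v, z⟫) / ‖v‖ ^ 2| ≤ 2 * ‖z‖ / ‖v‖ := by
  rw [abs_div, abs_mul, abs_of_pos (by positivity : 0 < ‖v‖ ^ 2), abs_two,
    div_le_div_iff₀ (by positivity) hv]
  have := abs_real_inner_le_norm v z
  nlinarith [mul_le_mul_of_nonneg_right this hv.le]

/-- Key negative-drift estimate: for `d ≥ 1`, `0 < α₀ ≤ α₂ < 2`, `β ∈ (0,1)`,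
there is `C > 0` such that for every `α ∈ [α₀,α₂]` and every `v` with `0 < |v| ≤ 1`,
`∫_{0<|z|≤|v|/2} (|v + (2⟨v,z⟩/|v|²)v|^β + |v − (2⟨v,z⟩/|v|²)v|^β − 2|v|^β) |z|^{−(d+α)} dz
  ≤ −C |v|^{β−α}`. -/
theorem stmt_13 (d : ℕ) (hd : 1 ≤ d) (α₀ α₂ β : ℝ)
    (h0 : 0 < α₀) (h1 : α₀ ≤ α₂) (h2 : α₂ < 2) (hβ0 : 0 < β) (hβ1 : β < 1) :
    ∃ C > 0, ∀ α ∈ Set.Icc α₀ α₂, ∀ v : EuclideanSpace ℝ (Fin d), 0 < ‖v‖ → ‖v‖ ≤ 1 →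
      (∫ z in {z : EuclideanSpace ℝ (Fin d) | 0 < ‖z‖ ∧ ‖z‖ ≤ ‖v‖ / 2},
          (‖v + ((2 * ⟪v, z⟫) / ‖v‖ ^ 2) • v‖ ^ β + ‖v - ((2 * ⟪v, z⟫) / ‖v‖ ^ 2) • v‖ ^ β
            - 2 * ‖v‖ ^ β) * ‖z‖ ^ (-((d : ℝ) + α))) ≤ -C * ‖v‖ ^ (β - α) := by
  obtain ⟨c, hc, hcb⟩ := aux_unif hβ0 hβ1
  have hfr : Module.finrank ℝ (EuclideanSpace ℝ (Fin d)) = d := by simp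
  have hnt : Nontrivial (EuclideanSpace ℝ (Fin d)) := by
    apply Module.nontrivial_of_finrank_pos (R := ℝ)
    omega
  set ω : ℝ := volume.real (Metric.ball (0 : EuclideanSpace ℝ (Fin d)) 1) with hω
  have hωpos : 0 < ω := by
    rw [hω, measureReal_def]
    exact ENNReal.toReal_pos (Metric.measure_ball_pos _ _ one_pos).ne' measure_ball_lt_top.ne
  refine ⟨c * ω * (1/16) ^ d, by positivity, ?_⟩
  rintro α ⟨hα0, hα2⟩ v hv hv1
  set S := {z : EuclideanSpace ℝ (Fin d) | 0 < ‖z‖ ∧ ‖z‖ ≤ ‖v‖ / 2} with hS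
  set F : EuclideanSpace ℝ (Fin d) → ℝ := fun z =>
    (‖v + ((2 * ⟪v, z⟫) / ‖v‖ ^ 2) • v‖ ^ β + ‖v - ((2 * ⟪v, z⟫) / ‖v‖ ^ 2) • v‖ ^ β
            - 2 * ‖v‖ ^ β) * ‖z‖ ^ (-((d : ℝ) + α)) with hF
  have hSm : MeasurableSet S := by
    apply MeasurableSet.inter
    · exact measurableSet_lt measurable_const measurable_norm
    · exact measurableSet_le measurable_norm measurable_const
  have ht1 : ∀ z ∈ S, |(2 * ⟪v, z⟫) / ‖v‖ ^ 2| ≤ 1 := by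
    intro z hz
    refine (aux_t v z hv).trans ?_
    rw [div_le_one hv]
    linarith [hz.2]
  have hFe : ∀ z ∈ S, F z = ‖v‖ ^ β * ((1 + (2 * ⟪v, z⟫) / ‖v‖ ^ 2) ^ β
      + (1 - (2 * ⟪v, z⟫) / ‖v‖ ^ 2) ^ β - 2) * ‖z‖ ^ (-((d : ℝ) + α)) := by
    intro z hz
    simp only [hF]
    rw [aux_eq v z (ht1 z hz)]
  have hF0 : ∀ z ∈ S, F z ≤ 0 := by
    intro z hz
    rw [hFe z hz]
    have := aux_nonpos hβ0 hβ1 (ht1 z hz)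
    exact mul_nonpos_of_nonpos_of_nonneg
      (mul_nonpos_of_nonneg_of_nonpos (by positivity) this) (by positivity)
  have hFm : Measurable F := by
    have hi : Measurable fun z : EuclideanSpace ℝ (Fin d) => (2 * ⟪v, z⟫) / ‖v‖ ^ 2 := by
      apply Continuous.measurable
      fun_prop
    have h1 : Measurable fun z : EuclideanSpace ℝ (Fin d) =>
        ‖v + ((2 * ⟪v, z⟫) / ‖v‖ ^ 2) • v‖ ^ β :=
      (((hi.smul_const v).const_add v).norm).pow_const β
    have h2 : Measurable fun z : EuclideanSpace ℝ (Fin d) =>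
        ‖v - ((2 * ⟪v, z⟫) / ‖v‖ ^ 2) • v‖ ^ β :=
      (((hi.smul_const v).const_sub v).norm).pow_const β
    exact ((h1.add h2).sub_const _).mul (measurable_norm.pow_const _)
  have hFint : IntegrableOn F S := by
    have hI : IntegrableOn (S.indicator F) (Metric.ball 0 ‖v‖) := by
      refine integrableOn_ball_of_norm_le_rpow (μ := volume) (C := ‖v‖ ^ β * (8 / ‖v‖ ^ 2))
        (α := d + α - 2) (by omega) (by rw [hfr]; linarith) ?_
        (hFm.indicator hSm).aestronglyMeasurable
      refine Filter.Eventually.of_forall fun z => ?_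
      by_cases hz : z ∈ S
      · rw [Set.indicator_of_mem hz, Real.norm_eq_abs, abs_of_nonpos (hF0 z hz), hFe z hz]
        have hl := aux_lower hβ0 hβ1 (ht1 z hz)
        have ht := aux_t v z hv
        have hzp : 0 < ‖z‖ := hz.1
        have hsq : ((2 * ⟪v, z⟫) / ‖v‖ ^ 2) ^ 2 ≤ 4 * ‖z‖ ^ 2 / ‖v‖ ^ 2 := by
          rw [← sq_abs]
          calc _ ≤ (2 * ‖z‖ / ‖v‖) ^ 2 := by gcongr
            _ = _ := by ring
        have hp : ‖z‖ ^ (-((d : ℝ) + α - 2)) = ‖z‖ ^ 2 * ‖z‖ ^ (-((d : ℝ) + α)) := by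
          rw [← Real.rpow_natCast ‖z‖ 2, ← Real.rpow_add hzp]
          congr 1; push_cast; ring
        rw [hp]
        set t := (2 * ⟪v, z⟫) / ‖v‖ ^ 2
        calc -(‖v‖ ^ β * ((1 + t) ^ β + (1 - t) ^ β - 2) * ‖z‖ ^ (-((d : ℝ) + α)))
            = ‖v‖ ^ β * (-((1 + t) ^ β + (1 - t) ^ β - 2)) * ‖z‖ ^ (-((d : ℝ) + α)) := by ring
          _ ≤ ‖v‖ ^ β * (2 * (4 * ‖z‖ ^ 2 / ‖v‖ ^ 2)) * ‖z‖ ^ (-((d : ℝ) + α)) := by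
              gcongr
              linarith
          _ = _ := by ring
      · rw [Set.indicator_of_notMem hz, norm_zero]
        positivity
    have hI2 : IntegrableOn (S.indicator F) S := hI.mono_set (fun z hz => by
      rw [mem_ball_zero_iff]
      linarith [hz.2])
    exact hI2.congr_fun (fun z hz => Set.indicator_of_mem hz F) hSm
  set B := Metric.ball ((3/8 : ℝ) • v) (‖v‖ / 16) with hB
  have hBz : ∀ z ∈ B, z ∈ S ∧ (1/2 : ℝ) ≤ (2 * ⟪v, z⟫) / ‖v‖ ^ 2 := by
    intro z hz
    rw [hB, mem_ball_iff_norm] at hz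
    have e : z = (3/8 : ℝ) • v + (z - (3/8 : ℝ) • v) := by abel
    have hn : ‖(3/8 : ℝ) • v‖ = 3/8 * ‖v‖ := by
      rw [norm_smul, Real.norm_of_nonneg (by norm_num)]
    have hin : ⟪v, z⟫ = 3/8 * ‖v‖ ^ 2 + ⟪v, z - (3/8 : ℝ) • v⟫ := by
      conv_lhs => rw [e]
      rw [inner_add_right, inner_smul_right, real_inner_self_eq_norm_sq]
    have hcs := (abs_le.1 (abs_real_inner_le_norm v (z - (3/8 : ℝ) • v))).1
    have hge : 5/16 * ‖v‖ ^ 2 ≤ ⟪v, z⟫ := by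
      nlinarith [mul_le_mul_of_nonneg_left hz.le hv.le]
    refine ⟨⟨?_, ?_⟩, ?_⟩
    · rw [norm_pos_iff]
      rintro rfl
      rw [inner_zero_right] at hge
      nlinarith
    · have := norm_sub_norm_le z ((3/8 : ℝ) • v)
      linarith
    · rw [le_div_iff₀ (by positivity)]
      nlinarith
  have hBS : B ⊆ S := fun z hz => (hBz z hz).1
  have hFB : ∀ z ∈ B, ‖v‖ ^ β * c * ‖v‖ ^ (-((d : ℝ) + α)) ≤ -F z := by
    intro z hz
    obtain ⟨hzS, hz2⟩ := hBz z hz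
    rw [hFe z hzS]
    have h3 := hcb _ ⟨hz2, (abs_le.1 (ht1 z hzS)).2⟩
    have hpow : ‖v‖ ^ (-((d : ℝ) + α)) ≤ ‖z‖ ^ (-((d : ℝ) + α)) := by
      apply Real.rpow_le_rpow_of_nonpos hzS.1
      · linarith [hzS.2]
      · have : (0 : ℝ) ≤ d := by positivity
        linarith
    set t := (2 * ⟪v, z⟫) / ‖v‖ ^ 2
    calc _ ≤ ‖v‖ ^ β * (-((1 + t) ^ β + (1 - t) ^ β - 2)) * ‖z‖ ^ (-((d : ℝ) + α)) := by
          have h4 : c ≤ -((1 + t) ^ β + (1 - t) ^ β - 2) := by linarith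
          have h5 : 0 ≤ -((1 + t) ^ β + (1 - t) ^ β - 2) := hc.le.trans h4
          gcongr
      _ = _ := by ring
  have k1 := setIntegral_ge_of_const_le (μ := volume) (s := B) Metric.isOpen_ball.measurableSet
    measure_ball_lt_top.ne hFB (hFint.mono_set hBS).neg
  have k2 : ∫ z in B, -F z ≤ ∫ z in S, -F z := by
    refine setIntegral_mono_set hFint.neg ?_ (Filter.Eventually.of_forall hBS)
    refine ae_restrict_of_forall_mem hSm fun z hz => ?_
    simpa using hF0 z hz
  have hvol : volume.real B = (‖v‖ / 16) ^ d * ω := by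
    rw [hB, hω, measureReal_def, Measure.addHaar_ball _ _ (by positivity), hfr,
      ENNReal.toReal_mul, ENNReal.toReal_ofReal (by positivity), measureReal_def]
  have k3 : ∫ z in S, -F z = -∫ z in S, F z := integral_neg F
  rw [hvol, smul_eq_mul] at k1
  have hfin : (‖v‖ / 16) ^ d * ω * (‖v‖ ^ β * c * ‖v‖ ^ (-((d : ℝ) + α)))
      = c * ω * (1/16) ^ d * ‖v‖ ^ (β - α) := by
    have : ‖v‖ ^ (β - α) = ‖v‖ ^ d * ‖v‖ ^ β * ‖v‖ ^ (-((d : ℝ) + α)) := by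
      rw [← Real.rpow_natCast ‖v‖ d, ← Real.rpow_add hv, ← Real.rpow_add hv]
      congr 1; ring
    rw [this, div_pow, one_div, inv_pow]
    ring
  rw [hfin] at k1
  have k4 := k1.trans k2
  rw [k3] at k4
  linarith
end

section
/- Let φ : (0,2] → ℝ be twice continuously differentiable with φ > 0, φ' < 0 and φ'' > 0 on (0,2], integrable on (0,2], and set f(r) = ∫₀^r φ(s) ds. Let x, y ∈ ℝ^d with x ≠ y and |x−y| ≤ 1, and let z ∈ ℝ^d with |z| ≤ |x−y|/2. With φ_{x,y}(z) = z − (2⟨x−y,z⟩/|x−y|²)(x−y), one has f( |x−y + (z − φ_{x,y}(z))| ) + f( |x−y − (z − φ_{x,y}(z))| ) − 2 f(|x−y|) ≤ 4 φ'(2|x−y|) · ⟨x−y,z⟩² / |x−y|². -/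
open MeasureTheory
open scoped RealInnerProductSpace

theorem aux_concave_s19 (φ φ' φ'' : ℝ → ℝ)
    (hd1 : ∀ r ∈ Set.Ioc (0:ℝ) 2, HasDerivWithinAt φ (φ' r) (Set.Ioc 0 2) r)
    (hd2 : ∀ r ∈ Set.Ioc (0:ℝ) 2, HasDerivWithinAt φ' (φ'' r) (Set.Ioc 0 2) r)
    (hconv : ∀ r ∈ Set.Ioc (0:ℝ) 2, 0 < φ'' r)
    (hint : IntegrableOn φ (Set.Ioc 0 2))
    (f : ℝ → ℝ) (hf : ∀ r, f r = ∫ s in Set.Ioc (0:ℝ) r, φ s)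
    (R : ℝ) (hR : 0 < R) (hR1 : R ≤ 1) :
    ConcaveOn ℝ (Set.Icc 0 (2 * R)) (fun r => f r - φ' (2 * R) * r ^ 2 / 2) := by
  have nh : ∀ r ∈ Set.Ioo (0:ℝ) 2, Set.Ioc (0:ℝ) 2 ∈ nhds r := fun r hr =>
    Filter.mem_of_superset (Ioo_mem_nhds hr.1 hr.2) Set.Ioo_subset_Ioc_self
  have D1 : ∀ r ∈ Set.Ioo (0:ℝ) 2, HasDerivAt φ (φ' r) r := fun r hr =>
    (hd1 r ⟨hr.1, hr.2.le⟩).hasDerivAt (nh r hr)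
  have D2 : ∀ r ∈ Set.Ioo (0:ℝ) 2, HasDerivAt φ' (φ'' r) r := fun r hr =>
    (hd2 r ⟨hr.1, hr.2.le⟩).hasDerivAt (nh r hr)
  have mono : MonotoneOn φ' (Set.Ioc 0 2) := by
    apply monotoneOn_of_deriv_nonneg (convex_Ioc 0 2)
    · exact fun r hr => (hd2 r hr).continuousWithinAt
    · rw [interior_Ioc]; exact fun r hr => (D2 r hr).differentiableAt.differentiableWithinAt
    · rw [interior_Ioc]; intro r hr; rw [(D2 r hr).deriv]; exact (hconv r ⟨hr.1, hr.2.le⟩).le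
  set c := φ' (2 * R) with hc
  have sub : Set.Ioo (0:ℝ) (2 * R) ⊆ Set.Ioo 0 2 := Set.Ioo_subset_Ioo_right (by linarith)
  have D3 : ∀ r ∈ Set.Ioo (0:ℝ) (2 * R), HasDerivAt (fun r => φ r - c * r) (φ' r - c) r := by
    intro r hr
    have := (D1 r (sub hr)).sub ((hasDerivAt_id r).const_mul c)
    exact this.congr_deriv (by ring)
  have anti : AntitoneOn (fun r => φ r - c * r) (Set.Ioo 0 (2 * R)) := by
    apply antitoneOn_of_deriv_nonpos (convex_Ioo _ _)
    · exact fun r hr => (D3 r hr).continuousAt.continuousWithinAt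
    · rw [interior_Ioo]; exact fun r hr => (D3 r hr).differentiableAt.differentiableWithinAt
    · rw [interior_Ioo]; intro r hr; rw [(D3 r hr).deriv]
      have := mono (a := r) (b := 2 * R) ⟨hr.1, (sub hr).2.le⟩ ⟨by linarith, by linarith⟩ hr.2.le
      linarith
  have Df : ∀ r ∈ Set.Ioo (0:ℝ) (2 * R), HasDerivAt f (φ r) r := by
    intro r hr
    have h2 := sub hr
    have hcont : ContinuousOn φ (Set.Ioo 0 2) := fun s hs =>
      (D1 s hs).continuousAt.continuousWithinAt
    have h : HasDerivAt (fun u => ∫ s in (0:ℝ)..u, φ s) (φ r) r := by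
      apply intervalIntegral.integral_hasDerivAt_right
      · rw [intervalIntegrable_iff_integrableOn_Ioc_of_le hr.1.le]
        exact hint.mono_set (Set.Ioc_subset_Ioc_right h2.2.le)
      · exact hcont.stronglyMeasurableAtFilter isOpen_Ioo r h2
      · exact (D1 r h2).continuousAt
    refine h.congr_of_eventuallyEq ?_
    filter_upwards [Ioi_mem_nhds hr.1] with s hs
    rw [hf, intervalIntegral.integral_of_le (le_of_lt hs)]
  have Dg : ∀ r ∈ Set.Ioo (0:ℝ) (2 * R),
      HasDerivAt (fun r => f r - c * r ^ 2 / 2) (φ r - c * r) r := by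
    intro r hr
    have := (Df r hr).sub ((((hasDerivAt_id r).pow 2).const_mul c).div_const 2)
    refine this.congr_deriv ?_
    simp; ring
  apply AntitoneOn.concaveOn_of_deriv (convex_Icc _ _)
  · have hfc : ContinuousOn f (Set.Icc 0 (2 * R)) := by
      rw [funext hf]
      apply intervalIntegral.continuousOn_primitive
      rw [integrableOn_Icc_iff_integrableOn_Ioc]
      exact hint.mono_set (Set.Ioc_subset_Ioc_right (by linarith))
    exact hfc.sub (by fun_prop)
  · rw [interior_Icc]; exact fun r hr => (Dg r hr).differentiableAt.differentiableWithinAt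
  · rw [interior_Icc]
    intro r hr s hs hrs
    rw [(Dg r hr).deriv, (Dg s hs).deriv]
    exact anti hr hs hrs

/-- For `φ ∈ 𝒟` with antiderivative `f(r) = ∫₀^r φ(s) ds`, points `x ≠ y` with
`|x−y| ≤ 1` and `|z| ≤ |x−y|/2`, with `φ_{x,y}` the reflection map, one has
`f(|x−y+(z−φ_{x,y}(z))|) + f(|x−y−(z−φ_{x,y}(z))|) − 2f(|x−y|)
  ≤ 4 φ'(2|x−y|) ⟨x−y,z⟩²/|x−y|²`. -/
theorem stmt_19 (d : ℕ) (hd : 1 ≤ d) (φ φ' φ'' : ℝ → ℝ)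
    (hd1 : ∀ r ∈ Set.Ioc (0:ℝ) 2, HasDerivWithinAt φ (φ' r) (Set.Ioc 0 2) r)
    (hd2 : ∀ r ∈ Set.Ioc (0:ℝ) 2, HasDerivWithinAt φ' (φ'' r) (Set.Ioc 0 2) r)
    (hcont : ContinuousOn φ'' (Set.Ioc 0 2))
    (hpos : ∀ r ∈ Set.Ioc (0:ℝ) 2, 0 < φ r)
    (hneg : ∀ r ∈ Set.Ioc (0:ℝ) 2, φ' r < 0)
    (hconv : ∀ r ∈ Set.Ioc (0:ℝ) 2, 0 < φ'' r)
    (hint : IntegrableOn φ (Set.Ioc 0 2))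
    (f : ℝ → ℝ) (hf : ∀ r, f r = ∫ s in Set.Ioc (0:ℝ) r, φ s)
    (x y z : EuclideanSpace ℝ (Fin d)) (hxy : x ≠ y) (hxy1 : ‖x - y‖ ≤ 1)
    (hz : ‖z‖ ≤ ‖x - y‖ / 2)
    (ψ : EuclideanSpace ℝ (Fin d) → EuclideanSpace ℝ (Fin d))
    (hψ : ∀ w, ψ w = w - ((2 * ⟪x - y, w⟫) / ‖x - y‖ ^ 2) • (x - y)) :
    f ‖x - y + (z - ψ z)‖ + f ‖x - y - (z - ψ z)‖ - 2 * f ‖x - y‖ ≤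
      4 * φ' (2 * ‖x - y‖) * ⟪x - y, z⟫ ^ 2 / ‖x - y‖ ^ 2 := by
  have hxy0 : x - y ≠ 0 := sub_ne_zero.mpr hxy
  have hR : 0 < ‖x - y‖ := norm_pos_iff.mpr hxy0
  set R := ‖x - y‖ with hRdef
  set q := ⟪x - y, z⟫ with hq
  have hqb : |q| ≤ R * (R / 2) :=
    (abs_real_inner_le_norm _ _).trans (mul_le_mul_of_nonneg_left hz hR.le)
  obtain ⟨hq1, hq2⟩ := abs_le.mp hqb
  have hu1 : -1 ≤ 2 * q / R ^ 2 := by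
    rw [le_div_iff₀ (by positivity)]; nlinarith
  have hu2 : 2 * q / R ^ 2 ≤ 1 := by
    rw [div_le_iff₀ (by positivity)]; nlinarith
  set a := 2 * q / R ^ 2 with ha
  have hψz : z - ψ z = a • (x - y) := by rw [hψ]; abel
  have n1 : ‖x - y + (z - ψ z)‖ = (1 + a) * R := by
    rw [hψz, show x - y + a • (x - y) = (1 + a) • (x - y) by module, norm_smul,
      Real.norm_of_nonneg (by linarith)]
  have n2 : ‖x - y - (z - ψ z)‖ = (1 - a) * R := by
    rw [hψz, show x - y - a • (x - y) = (1 - a) • (x - y) by module, norm_smul,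
      Real.norm_of_nonneg (by linarith)]
  rw [n1, n2]
  have hrhs : 4 * φ' (2 * R) * q ^ 2 / R ^ 2 = φ' (2 * R) * (a * R) ^ 2 := by
    rw [ha]; field_simp; ring
  rw [hrhs]
  have key := aux_concave_s19 φ φ' φ'' hd1 hd2 hconv hint f hf R hR hxy1
  have m1 : (1 + a) * R ∈ Set.Icc 0 (2 * R) := ⟨by nlinarith, by nlinarith⟩
  have m2 : (1 - a) * R ∈ Set.Icc 0 (2 * R) := ⟨by nlinarith, by nlinarith⟩
  have h := (id key : _ ∧ _).2 m1 m2 (show (0:ℝ) ≤ 1 / 2 by norm_num)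
    (show (0:ℝ) ≤ 1 / 2 by norm_num) (by norm_num)
  simp only [smul_eq_mul] at h
  rw [show 1 / 2 * ((1 + a) * R) + 1 / 2 * ((1 - a) * R) = R by ring] at h
  nlinarith
end
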